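/- Let d ≥ 3 and let Δ be a normal d-pseudomanifold with g_2(Δ) = p such that g_2(lk_Δ v) ≥ 1 for every vertex v of Δ. If u is a vertex of Δ with g_2(Δ[V(st_Δ u)]) = p − 1, then any two vertices of Δ lying outside st_Δ u are joined by an edge of Δ; that is, the graph of the induced subcomplex Δ[V(Δ \ st_Δ u)] is a complete graph. -/

import Mathlib

/-!
Common definitions: finite abstract simplicial complexes (with vertices in ℕ),
links, f-vectors, g-numbers, reduced simplicial homology over a field (via Betti
numbers of the simplicial chain complex), homology spheres/manifolds, geometric
realization and triangulated spheres/balls, normal pseudomanifolds, and the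
combinatorial operations (bistellar moves, edge contraction/expansion, edge
flips) used in the paper.
-/

noncomputable section

/-- A finite abstract simplicial complex with vertex set contained in `ℕ`:
a finite, downward closed family of finite sets (faces). -/
structure SComplex where
  faces : Finset (Finset ℕ)
  down : ∀ σ ∈ faces, ∀ τ ⊆ σ, τ ∈ faces

namespace SComplex

/-- The vertex set of a complex. -/
def vertexSet (Δ : SComplex) : Finset ℕ := Δ.faces.biUnion id

/-- The link of a face `σ`:
`lk_Δ σ = {γ ∈ Δ : γ ∩ σ = ∅ and γ ∪ σ ∈ Δ}`. -/
def link (Δ : SComplex) (σ : Finset ℕ) : SComplex where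
  faces := Δ.faces.filter fun γ => γ ∩ σ = ∅ ∧ γ ∪ σ ∈ Δ.faces
  down := by
    intro γ hγ τ hτ
    simp only [Finset.mem_filter] at hγ ⊢
    obtain ⟨h1, h2, h3⟩ := hγ
    refine ⟨Δ.down γ h1 τ hτ, ?_,
      Δ.down _ h3 _ (Finset.union_subset_union hτ (Finset.Subset.refl σ))⟩
    have h4 : τ ∩ σ ⊆ γ ∩ σ := Finset.inter_subset_inter hτ (Finset.Subset.refl σ)
    rw [h2] at h4
    exact Finset.subset_empty.mp h4

/-- The induced subcomplex on a set `W` of vertices. -/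
def induced (Δ : SComplex) (W : Finset ℕ) : SComplex where
  faces := Δ.faces.filter fun σ => σ ⊆ W
  down := by
    intro σ hσ τ hτ
    simp only [Finset.mem_filter] at hσ ⊢
    exact ⟨Δ.down σ hσ.1 τ hτ, hτ.trans hσ.2⟩

/-- `fVec Δ i = f_i(Δ)`, the number of `i`-dimensional faces. -/
def fVec (Δ : SComplex) (i : ℕ) : ℕ := (Δ.faces.filter fun σ => σ.card = i + 1).card

/-- `g₂` of a pure `d`-dimensional complex: `g₂ = f₁ - (d+1)·f₀ + C(d+2, 2)`. -/
def g2 (Δ : SComplex) (d : ℕ) : ℤ :=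
  (Δ.fVec 1 : ℤ) - ((d : ℤ) + 1) * (Δ.fVec 0 : ℤ) + (Nat.choose (d + 2) 2 : ℤ)

/-- `g₃` of a pure `d`-dimensional complex:
`g₃ = f₂ - d·f₁ + C(d+1,2)·f₀ - C(d+2,3)`. -/
def g3 (Δ : SComplex) (d : ℕ) : ℤ :=
  (Δ.fVec 2 : ℤ) - (d : ℤ) * (Δ.fVec 1 : ℤ) + (Nat.choose (d + 1) 2 : ℤ) * (Δ.fVec 0 : ℤ)
    - (Nat.choose (d + 2) 3 : ℤ)

/-- A complex is pure of dimension `d` if every face is contained in a face with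
`d+1` vertices and no face has more than `d+1` vertices. -/
def IsPure (Δ : SComplex) (d : ℕ) : Prop :=
  (∀ σ ∈ Δ.faces, σ.card ≤ d + 1) ∧
  ∀ σ ∈ Δ.faces, ∃ τ ∈ Δ.faces, σ ⊆ τ ∧ τ.card = d + 1

/-- `σ` is a missing face of `Δ`: its boundary is in `Δ` but `σ` is not. -/
def IsMissing (Δ : SComplex) (σ : Finset ℕ) : Prop :=
  σ ∉ Δ.faces ∧ ∀ τ ⊂ σ, τ ∈ Δ.faces

/-- A pure `d`-dimensional complex is prime if it has no missing facets
(missing faces with `d+1` vertices). -/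
def IsPrime (Δ : SComplex) (d : ℕ) : Prop :=
  ∀ σ : Finset ℕ, σ.card = d + 1 → ¬ Δ.IsMissing σ

/-- The faces of `Δ` with exactly `n` vertices. -/
def facesOfCard (Δ : SComplex) (n : ℕ) : Finset (Finset ℕ) :=
  Δ.faces.filter fun σ => σ.card = n

/-- The matrix of the simplicial boundary map from chains spanned by faces with
`n+1` vertices to chains spanned by faces with `n` vertices, with the standard
signs coming from the natural order on the vertices. -/
def bdryMat (F : Type*) [Field F] (Δ : SComplex) (n : ℕ) :
    Matrix ↥(Δ.facesOfCard n) ↥(Δ.facesOfCard (n + 1)) F := fun τ σ =>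
  if (τ : Finset ℕ) ⊆ (σ : Finset ℕ) then
    ∑ v ∈ (σ : Finset ℕ) \ (τ : Finset ℕ),
      (-1 : F) ^ (((σ : Finset ℕ).filter fun x => x < v).card)
  else 0

/-- The simplicial boundary map (as a linear map) of the reduced simplicial chain
complex of `Δ` over `F`; chains in level `n` are spanned by the faces with `n`
vertices (so the empty face spans the level-0 part, giving the *reduced*
chain complex). -/
def bdry (F : Type*) [Field F] (Δ : SComplex) (n : ℕ) :
    (↥(Δ.facesOfCard (n + 1)) → F) →ₗ[F] ↥(Δ.facesOfCard n) → F :=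
  (Δ.bdryMat F n).mulVecLin

/-- `betti F Δ n` is the reduced Betti number `b̃_{n-1}(Δ; F)`: the dimension of
the reduced simplicial homology of `Δ` over `F` in degree `n - 1` (chains in
level `n` are spanned by the faces with `n` vertices). -/
def betti (F : Type*) [Field F] (Δ : SComplex) : ℕ → ℕ
  | 0 => (Δ.facesOfCard 0).card - Module.finrank F ↥(LinearMap.range (Δ.bdry F 0))
  | n + 1 =>
      Module.finrank F ↥(LinearMap.ker (Δ.bdry F n)) -
        Module.finrank F ↥(LinearMap.range (Δ.bdry F (n + 1)))

/-- `Δ` has the same reduced homology over `F` as the sphere `S^m`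
(`m : ℤ`, possibly `-1`): all reduced Betti numbers vanish except in degree `m`,
where the Betti number is `1`. -/
def SameHomologyAsSphere (F : Type*) [Field F] (Δ : SComplex) (m : ℤ) : Prop :=
  ∀ n : ℕ, (Δ.betti F n : ℤ) = if (n : ℤ) = m + 1 then 1 else 0

/-- `Δ` is an `F`-homology `d`-sphere: for every face `σ` (including the empty
face), the link of `σ` has the same reduced homology over `F` as the sphere of
dimension `d - |σ|`. -/
def IsHomologySphere (F : Type*) [Field F] (Δ : SComplex) (d : ℤ) : Prop :=
  Δ.faces.Nonempty ∧
  ∀ σ ∈ Δ.faces, (Δ.link σ).SameHomologyAsSphere F (d - (σ.card : ℤ))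

/-- `Δ` is an `F`-homology `d`-manifold: it is pure of dimension `d` and the link
of every vertex is an `F`-homology `(d-1)`-sphere. -/
def IsHomologyManifold (F : Type*) [Field F] (Δ : SComplex) (d : ℕ) : Prop :=
  Δ.IsPure d ∧ ∀ v ∈ Δ.vertexSet, (Δ.link {v}).IsHomologySphere F ((d : ℤ) - 1)

/-- The geometric realization of `Δ`: convex combinations of vertices supported
on faces of `Δ`, inside `ℕ → ℝ`. -/
def realization (Δ : SComplex) : Set (ℕ → ℝ) :=
  {f | ∃ σ ∈ Δ.faces, (∀ v, v ∉ σ → f v = 0) ∧ (∀ v, 0 ≤ f v) ∧ ∑ v ∈ σ, f v = 1}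

/-- `Δ` is a triangulated `d`-sphere: its geometric realization is homeomorphic
to the unit sphere in `ℝ^{d+1}`. -/
def IsTriangulatedSphere (Δ : SComplex) (d : ℕ) : Prop :=
  Nonempty (↥Δ.realization ≃ₜ ↥(Metric.sphere (0 : EuclideanSpace ℝ (Fin (d + 1))) 1))

/-- `Δ` is a triangulated `d`-ball: its geometric realization is homeomorphic
to the closed unit ball in `ℝ^d`. -/
def IsTriangulatedBall (Δ : SComplex) (d : ℕ) : Prop :=
  Nonempty (↥Δ.realization ≃ₜ ↥(Metric.closedBall (0 : EuclideanSpace ℝ (Fin d)) 1))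

/-- Two vertices are related if they span an edge of `Δ`. -/
def EdgeRel (Δ : SComplex) (x y : ℕ) : Prop :=
  x ≠ y ∧ ({x, y} : Finset ℕ) ∈ Δ.faces

/-- `Δ` is connected: it has a vertex, and any two vertices are joined by a path
of edges. -/
def IsConnectedC (Δ : SComplex) : Prop :=
  Δ.vertexSet.Nonempty ∧
  ∀ x ∈ Δ.vertexSet, ∀ y ∈ Δ.vertexSet, Relation.ReflTransGen Δ.EdgeRel x y

/-- Two facets of a pure `d`-complex are adjacent if they share a ridge. -/
def FacetAdj (Δ : SComplex) (d : ℕ) (σ τ : Finset ℕ) : Prop :=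
  σ ∈ Δ.faces ∧ τ ∈ Δ.faces ∧ σ.card = d + 1 ∧ τ.card = d + 1 ∧ (σ ∩ τ).card = d

/-- `Δ` is strongly connected: any two facets are joined by a chain of facets in
which consecutive facets share a ridge. -/
def StronglyConnected (Δ : SComplex) (d : ℕ) : Prop :=
  ∀ σ ∈ Δ.faces, ∀ τ ∈ Δ.faces, σ.card = d + 1 → τ.card = d + 1 →
    Relation.ReflTransGen (Δ.FacetAdj d) σ τ

/-- `Δ` is a normal `d`-pseudomanifold: pure, strongly connected, every
`(d-1)`-face lies in exactly two facets, and the link of every face of dimension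
at most `d-2` is connected. -/
def IsNormalPseudomanifold (Δ : SComplex) (d : ℕ) : Prop :=
  Δ.IsPure d ∧ Δ.StronglyConnected d ∧
  (∀ σ ∈ Δ.faces, σ.card = d →
    (Δ.faces.filter fun τ => σ ⊆ τ ∧ τ.card = d + 1).card = 2) ∧
  ∀ σ ∈ Δ.faces, σ.card + 1 ≤ d → IsConnectedC (Δ.link σ)

/-- The face set of the join of two (vertex-disjoint) complexes, given by their
face sets: all unions `σ ∪ τ`. -/
def joinFaces (A B : Finset (Finset ℕ)) : Finset (Finset ℕ) :=
  (A ×ˢ B).image fun p => p.1 ∪ p.2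

/-- The face set of the boundary complex `∂σ` of a simplex `σ`:
all proper subsets of `σ`. -/
def bdryFaces (σ : Finset ℕ) : Finset (Finset ℕ) := σ.powerset.erase σ

/-- `C` is an `n`-cycle: a connected pure 1-dimensional complex on `n ≥ 3`
vertices in which every vertex has exactly two neighbours. -/
def IsCycle (C : SComplex) (n : ℕ) : Prop :=
  3 ≤ n ∧ C.vertexSet.card = n ∧ C.IsPure 1 ∧ IsConnectedC C ∧
  ∀ v ∈ C.vertexSet, ((C.link {v}).vertexSet).card = 2

/-- The vertex set of the closed star of the vertex `u`. -/
def closedStarVerts (Δ : SComplex) (u : ℕ) : Finset ℕ :=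
  insert u (Δ.link {u}).vertexSet

/-- The degree of a vertex: `d(u) = f₀(lk_Δ u)`. -/
def degree (Δ : SComplex) (u : ℕ) : ℕ := (Δ.link {u}).fVec 0

/-- `Δ'` is obtained from `Δ` by a bistellar `i`-move in dimension `d`: for a
`(d-i)`-face `σ` with `lk_Δ σ = ∂τ`, where `τ` is an `i`-simplex not in `Δ`,
replace `σ ⋆ ∂τ` by `τ ⋆ ∂σ`. -/
def BistellarMove (d i : ℕ) (Δ Δ' : SComplex) : Prop :=
  ∃ σ τ : Finset ℕ, σ ∈ Δ.faces ∧ σ.card = d - i + 1 ∧ τ.card = i + 1 ∧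
    τ ∉ Δ.faces ∧ (Δ.link σ).faces = bdryFaces τ ∧
    Δ'.faces = (Δ.faces.filter fun α => ¬ σ ⊆ α) ∪ joinFaces τ.powerset (bdryFaces σ)

/-- `Δ'` is obtained from the `d`-dimensional complex `Δ` by contracting an edge
`uv` satisfying the link condition (with one of the two vertex links a
triangulated `(d-1)`-sphere), identifying `v` with `u`. -/
def EdgeContraction (d : ℕ) (Δ Δ' : SComplex) : Prop :=
  ∃ u v : ℕ, u ≠ v ∧ ({u, v} : Finset ℕ) ∈ Δ.faces ∧
    ((Δ.link {u}).IsTriangulatedSphere (d - 1) ∨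
      (Δ.link {v}).IsTriangulatedSphere (d - 1)) ∧
    (Δ.link {u}).faces ∩ (Δ.link {v}).faces = (Δ.link ({u, v} : Finset ℕ)).faces ∧
    Δ'.faces = Δ.faces.image fun σ => σ.image fun x => if x = v then u else x

/-- `Δ'` is obtained from the normal 4-pseudomanifold `Δ` by an edge expansion:
for a vertex `w` and a triangulated 2-sphere `S` separating `lk_Δ w` into a
triangulated 3-ball `D₁` and a complex `D₂` with common boundary `S`,
`Δ' = (Δ \ st_Δ w) ∪ (uv ⋆ S) ∪ (u ⋆ D₁) ∪ (v ⋆ D₂)` with `u`, `v` new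
vertices. -/
def EdgeExpansion (Δ Δ' : SComplex) : Prop :=
  ∃ w u v : ℕ, ∃ S D₁ D₂ : SComplex,
    ({w} : Finset ℕ) ∈ Δ.faces ∧ u ≠ v ∧ u ∉ Δ.vertexSet ∧ v ∉ Δ.vertexSet ∧
    S.IsTriangulatedSphere 2 ∧ D₁.IsTriangulatedBall 3 ∧
    D₁.faces ∪ D₂.faces = (Δ.link {w}).faces ∧
    D₁.faces ∩ D₂.faces = S.faces ∧
    Δ'.faces = (Δ.faces.filter fun σ => w ∉ σ) ∪
      joinFaces ({u, v} : Finset ℕ).powerset S.faces ∪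
      joinFaces ({u} : Finset ℕ).powerset D₁.faces ∪
      joinFaces ({v} : Finset ℕ).powerset D₂.faces

/-- `Δ'` is obtained from the normal 4-pseudomanifold `Δ` by flipping an edge
`ab` with `lk_Δ ab = ∂(cd) ⋆ ∂(xyz)` (where `cd` is a missing edge of `Δ`) by
`cd`: replace `ab ⋆ ∂(cd) ⋆ ∂(xyz)` by `∂(ab) ⋆ cd ⋆ ∂(xyz)`. -/
def EdgeFlip (Δ Δ' : SComplex) : Prop :=
  ∃ a b c d x y z : ℕ,
    ({a, b} : Finset ℕ).card = 2 ∧ ({c, d} : Finset ℕ).card = 2 ∧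
    ({x, y, z} : Finset ℕ).card = 3 ∧
    ({a, b} : Finset ℕ) ∈ Δ.faces ∧ Δ.IsMissing {c, d} ∧
    (Δ.link ({a, b} : Finset ℕ)).faces =
      joinFaces (bdryFaces {c, d}) (bdryFaces {x, y, z}) ∧
    Δ'.faces = (Δ.faces.filter fun α => ¬ ({a, b} : Finset ℕ) ⊆ α) ∪
      joinFaces (joinFaces (bdryFaces {a, b}) (({c, d} : Finset ℕ).powerset))
        (bdryFaces {x, y, z})

/-- Operation (i) on 4-dimensional complexes: `Δ` is obtained from `Δ'` by a
bistellar 1-move followed by an edge contraction. -/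
def Op1 (Δ' Δ : SComplex) : Prop :=
  ∃ M : SComplex, BistellarMove 4 1 Δ' M ∧ EdgeContraction 4 M Δ

/-- Operation (ii) on 4-dimensional complexes: `Δ` is obtained from `Δ'` by an
edge expansion together with finitely many (possibly zero) edge flippings or
bistellar 2-moves. -/
def Op2 (Δ' Δ : SComplex) : Prop :=
  ∃ M : SComplex, EdgeExpansion Δ' M ∧
    Relation.ReflTransGen (fun X Y => EdgeFlip X Y ∨ BistellarMove 4 2 X Y) M Δ

/-- Membership in the class `H_α`: prime `F`-homology 4-manifolds with
`g₂ = α` all of whose vertex links are prime. -/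
def MemH (F : Type*) [Field F] (Δ : SComplex) (α : ℕ) : Prop :=
  Δ.IsHomologyManifold F 4 ∧ Δ.g2 4 = (α : ℤ) ∧ Δ.IsPrime 4 ∧
    ∀ v ∈ Δ.vertexSet, (Δ.link {v}).IsPrime 3

/-- Property (*): whenever the link of a vertex `u` is `C ⋆ ∂(pqc)` for a cycle
`C` and a 2-simplex `pqc`, the triangle `pqc` is a face of `Δ` and every vertex
of `C` is incident to at least one diagonal edge (an edge of `Δ` joining two
vertices of `C` that are not adjacent in `C`). -/
def PropertyStar (Δ : SComplex) : Prop :=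
  ∀ (u : ℕ) (C : SComplex) (p q c : ℕ) (n : ℕ),
    ({u} : Finset ℕ) ∈ Δ.faces → IsCycle C n → ({p, q, c} : Finset ℕ).card = 3 →
    (Δ.link {u}).faces = joinFaces C.faces (bdryFaces {p, q, c}) →
    ({p, q, c} : Finset ℕ) ∈ Δ.faces ∧
      ∀ x ∈ C.vertexSet, ∃ y ∈ C.vertexSet,
        x ≠ y ∧ ({x, y} : Finset ℕ) ∉ C.faces ∧ ({x, y} : Finset ℕ) ∈ Δ.faces

/-- `Δ` is an octahedral 3-sphere:
`Δ = ∂(a₁b₁) ⋆ ∂(a₂b₂) ⋆ ∂(a₃b₃) ⋆ ∂(a₄b₄)`. -/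
def IsOctahedral3Sphere (Δ : SComplex) : Prop :=
  ∃ a₁ b₁ a₂ b₂ a₃ b₃ a₄ b₄ : ℕ,
    ({a₁, b₁, a₂, b₂, a₃, b₃, a₄, b₄} : Finset ℕ).card = 8 ∧
    Δ.faces = joinFaces (joinFaces (bdryFaces {a₁, b₁}) (bdryFaces {a₂, b₂}))
      (joinFaces (bdryFaces {a₃, b₃}) (bdryFaces {a₄, b₄}))

end SComplex

namespace SComplex

/-- neighbours -/
def nb (Δ : SComplex) (v : ℕ) : Finset ℕ := (Δ.link {v}).vertexSet

/-- number of edges meeting `R` -/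
def touch (Δ : SComplex) (R : Finset ℕ) : ℕ :=
  ((Δ.facesOfCard 2).filter fun e => ¬ Disjoint e R).card

/-- excess -/
def exc (Δ : SComplex) (k : ℕ) (R : Finset ℕ) : ℤ :=
  (Δ.touch R : ℤ) - ((k : ℤ) + 1) * (R.card : ℤ)

/-- normal pseudomanifold, without strong connectivity, nonempty -/
def NPM (Δ : SComplex) (k : ℕ) : Prop :=
  ∅ ∈ Δ.faces ∧ Δ.IsPure k ∧
  (∀ σ ∈ Δ.faces, σ.card = k →
    (Δ.faces.filter fun τ => σ ⊆ τ ∧ τ.card = k + 1).card = 2) ∧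
  ∀ σ ∈ Δ.faces, σ.card + 1 ≤ k → IsConnectedC (Δ.link σ)

lemma mem_link {Δ : SComplex} {σ γ : Finset ℕ} :
    γ ∈ (Δ.link σ).faces ↔ γ ∩ σ = ∅ ∧ γ ∪ σ ∈ Δ.faces := by
  simp only [link, Finset.mem_filter]
  constructor
  · rintro ⟨_, h⟩; exact h
  · rintro ⟨h1, h2⟩; exact ⟨Δ.down _ h2 _ Finset.subset_union_left, h1, h2⟩

lemma mem_vertexSet {Δ : SComplex} {v : ℕ} : v ∈ Δ.vertexSet ↔ {v} ∈ Δ.faces := by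
  simp only [vertexSet, Finset.mem_biUnion, id]
  constructor
  · rintro ⟨a, h, hv⟩; exact Δ.down _ h _ (by simpa using hv)
  · intro h; exact ⟨_, h, by simp⟩

lemma mem_nb {Δ : SComplex} {v w : ℕ} : w ∈ Δ.nb v ↔ w ≠ v ∧ ({v, w} : Finset ℕ) ∈ Δ.faces := by
  rw [nb, mem_vertexSet, mem_link]
  have : ({w} ∪ {v} : Finset ℕ) = {v, w} := by ext; simp; tauto
  rw [this, ← Finset.disjoint_iff_inter_eq_empty]
  simp

lemma nb_symm {Δ : SComplex} {v w : ℕ} : w ∈ Δ.nb v ↔ v ∈ Δ.nb w := by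
  rw [mem_nb, mem_nb, Finset.pair_comm]; tauto

lemma nb_edgeRel {Δ : SComplex} {v w : ℕ} : Δ.EdgeRel v w ↔ w ∈ Δ.nb v := by
  rw [mem_nb, EdgeRel]; tauto

lemma not_mem_nb_self {Δ : SComplex} {v : ℕ} : v ∉ Δ.nb v := by simp [mem_nb]

lemma nb_subset {Δ : SComplex} {v : ℕ} : Δ.nb v ⊆ Δ.vertexSet := by
  intro w hw
  rw [mem_nb] at hw; rw [mem_vertexSet]; exact Δ.down _ hw.2 _ (by simp)

lemma mem_vs_of_mem {Δ : SComplex} {σ : Finset ℕ} (h : σ ∈ Δ.faces) : σ ⊆ Δ.vertexSet := by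
  intro x hx; rw [mem_vertexSet]; exact Δ.down _ h _ (by simpa using hx)

lemma link_link {Δ : SComplex} {v : ℕ} {σ : Finset ℕ} (h : v ∉ σ) :
    (Δ.link {v}).link σ = Δ.link (insert v σ) := by
  have : ((Δ.link {v}).link σ).faces = (Δ.link (insert v σ)).faces := by
    ext γ
    rw [mem_link, mem_link, mem_link]
    have h1 : γ ∪ σ ∪ {v} = γ ∪ insert v σ := by ext; simp
    rw [h1]
    simp only [← Finset.disjoint_iff_inter_eq_empty]
    simp [h]
    tauto
  cases hA : (Δ.link {v}).link σ; cases hB : Δ.link (insert v σ)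
  simp_all

lemma link_empty {Δ : SComplex} : Δ.link ∅ = Δ := by
  have : (Δ.link ∅).faces = Δ.faces := by
    ext γ
    rw [mem_link]; simp
  cases hA : Δ.link ∅; cases Δ
  simp_all

lemma mem_link_singleton {Δ : SComplex} {v : ℕ} {γ : Finset ℕ} :
    γ ∈ (Δ.link {v}).faces ↔ v ∉ γ ∧ insert v γ ∈ Δ.faces := by
  rw [mem_link, ← Finset.disjoint_iff_inter_eq_empty]
  simp

lemma NPM.link {Δ : SComplex} {k : ℕ} (h : Δ.NPM (k+1)) {v : ℕ} (hv : {v} ∈ Δ.faces) :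
    (Δ.link {v}).NPM k := by
  obtain ⟨h0, ⟨hc, hp⟩, hr, hl⟩ := h
  refine ⟨?_, ⟨?_, ?_⟩, ?_, ?_⟩
  · rw [mem_link_singleton]; simpa using hv
  · intro σ hσ
    rw [mem_link_singleton] at hσ
    have := hc _ hσ.2
    rw [Finset.card_insert_of_notMem hσ.1] at this
    omega
  · intro σ hσ
    rw [mem_link_singleton] at hσ
    obtain ⟨τ, h1, h2, h3⟩ := hp _ hσ.2
    have hvt : v ∈ τ := h2 (by simp)
    refine ⟨τ.erase v, ?_, ?_, ?_⟩
    · rw [mem_link_singleton]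
      simpa [Finset.insert_erase hvt] using h1
    · intro x hx; rw [Finset.mem_erase]; exact ⟨by rintro rfl; exact hσ.1 hx, h2 (by simp [hx])⟩
    · rw [Finset.card_erase_of_mem hvt]; omega
  · intro σ hσ hk
    rw [mem_link_singleton] at hσ
    rw [← hr _ hσ.2 (by rw [Finset.card_insert_of_notMem hσ.1, hk])]
    apply Finset.card_bij (fun τ _ => insert v τ)
    · intro τ ht
      simp only [Finset.mem_filter, mem_link_singleton] at ht ⊢
      refine ⟨ht.1.2, Finset.insert_subset_insert _ ht.2.1, ?_⟩
      rw [Finset.card_insert_of_notMem ht.1.1]; omega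
    · intro a ha b hb hab
      simp only [Finset.mem_filter, mem_link_singleton] at ha hb
      rw [← Finset.erase_insert ha.1.1, hab, Finset.erase_insert hb.1.1]
    · intro b hb
      simp only [Finset.mem_filter] at hb
      have hvb : v ∈ b := hb.2.1 (by simp)
      refine ⟨b.erase v, ?_, Finset.insert_erase hvb⟩
      simp only [Finset.mem_filter, mem_link_singleton]
      refine ⟨⟨by simp, by rw [Finset.insert_erase hvb]; exact hb.1⟩, ?_, ?_⟩
      · intro x hx; rw [Finset.mem_erase]
        exact ⟨by rintro rfl; exact hσ.1 hx, hb.2.1 (by simp [hx])⟩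
      · rw [Finset.card_erase_of_mem hvb]; omega
  · intro σ hσ hk
    rw [mem_link_singleton] at hσ
    rw [link_link hσ.1]
    apply hl _ hσ.2
    rw [Finset.card_insert_of_notMem hσ.1]; omega

lemma NPM.conn {Δ : SComplex} {k : ℕ} (h : Δ.NPM k) (hk : 1 ≤ k) : Δ.IsConnectedC := by
  have := h.2.2.2 ∅ h.1 (by simpa using hk)
  rwa [link_empty] at this

lemma sc_aux {Δ : SComplex} {k : ℕ} (h : Δ.NPM k) (hk : 1 ≤ k)
    (hstar : ∀ v, ∀ σ ∈ Δ.faces, ∀ τ ∈ Δ.faces, v ∈ σ → v ∈ τ → σ.card = k+1 → τ.card = k+1 →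
      Relation.ReflTransGen (Δ.FacetAdj k) σ τ) : Δ.StronglyConnected k := by
  intro σ hσ τ hτ cσ cτ
  obtain ⟨x, hx⟩ : σ.Nonempty := by rw [← Finset.card_pos]; omega
  obtain ⟨y, hy⟩ : τ.Nonempty := by rw [← Finset.card_pos]; omega
  have hp := (h.conn hk).2 x (mem_vs_of_mem hσ hx) y (mem_vs_of_mem hτ hy)
  have key : ∀ τ ∈ Δ.faces, y ∈ τ → τ.card = k+1 → Relation.ReflTransGen (Δ.FacetAdj k) σ τ := by
    clear cτ hy hτ τ
    induction hp with
    | refl => intro τ hτ hy cτ; exact hstar x _ hσ _ hτ hx hy cσ cτ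
    | tail _ hbc ih =>
      rename_i b c _
      intro τ hτ hy cτ
      obtain ⟨ρ, h1, h2, h3⟩ := h.2.1.2 _ hbc.2
      exact (ih ρ h1 (h2 (by simp)) h3).trans (hstar c _ h1 _ hτ (h2 (by simp)) hy h3 cτ)
  exact key τ hτ hy cτ

lemma NPM.strong {k : ℕ} : ∀ {Δ : SComplex}, Δ.NPM (k+1) → Δ.StronglyConnected (k+1) := by
  induction k with
  | zero =>
    intro Δ h
    apply sc_aux h (by omega)
    intro v σ hσ τ hτ v1 v2 c1 c2
    by_cases e : σ = τ
    · rw [e]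
    · apply Relation.ReflTransGen.single
      refine ⟨hσ, hτ, c1, c2, ?_⟩
      have h1 : 1 ≤ (σ ∩ τ).card := by
        rw [Nat.succ_le_iff, Finset.card_pos]; exact ⟨v, by simp [v1, v2]⟩
      have h2 : (σ ∩ τ).card ≠ 2 := by
        intro h2
        apply e
        have e1 := Finset.eq_of_subset_of_card_le (Finset.inter_subset_left : σ ∩ τ ⊆ σ) (by omega)
        have e2 := Finset.eq_of_subset_of_card_le (Finset.inter_subset_right : σ ∩ τ ⊆ τ) (by omega)
        rw [← e1, e2]
      have h3 : (σ ∩ τ).card ≤ σ.card := Finset.card_le_card Finset.inter_subset_left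
      omega
  | succ k ih =>
    intro Δ h
    apply sc_aux h (by omega)
    intro v σ hσ τ hτ v1 v2 c1 c2
    have hv : {v} ∈ Δ.faces := Δ.down _ hσ _ (by simpa using v1)
    have := ih (h.link hv) (σ.erase v) (by rw [mem_link_singleton]; simp [Finset.insert_erase v1, hσ])
      (τ.erase v) (by rw [mem_link_singleton]; simp [Finset.insert_erase v2, hτ])
      (by rw [Finset.card_erase_of_mem v1]; omega) (by rw [Finset.card_erase_of_mem v2]; omega)
    have := Relation.ReflTransGen.lift (p := Δ.FacetAdj (k+1+1)) (fun s => insert v s) ?_ _ _ this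
    · simpa [Function.onFun, Finset.insert_erase v1, Finset.insert_erase v2] using this
    · rintro a b ⟨ha, hb, ca, cb, cab⟩
      rw [mem_link_singleton] at ha hb
      refine ⟨ha.2, hb.2, ?_, ?_, ?_⟩
      · rw [Finset.card_insert_of_notMem ha.1]; omega
      · rw [Finset.card_insert_of_notMem hb.1]; omega
      · rw [← Finset.insert_inter_distrib, Finset.card_insert_of_notMem (by simp [ha.1])]; omega

/-- connectivity across a partition, generic -/
lemma rtg_cross {α : Type*} {r : α → α → Prop} {p : α → Prop} {a b : α}
    (h : Relation.ReflTransGen r a b) (ha : p a) (hb : ¬ p b) : ∃ x y, r x y ∧ p x ∧ ¬ p y := by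
  induction h with
  | refl => exact absurd ha hb
  | tail _ hbc ih =>
    rename_i b c _
    by_cases hpb : p b
    · exact ⟨b, c, hbc, hpb, hb⟩
    · exact ih hpb

end SComplex

namespace SComplex

lemma mem_foc {Δ : SComplex} {n : ℕ} {σ : Finset ℕ} :
    σ ∈ Δ.facesOfCard n ↔ σ ∈ Δ.faces ∧ σ.card = n := by simp [facesOfCard]

lemma card_between {Δ : SComplex} {k : ℕ} {ρ t : Finset ℕ} (ht : t ∈ Δ.faces) (hρ : ρ.card + 1 = k)
    (hc : t.card = k + 1) (hs : ρ ⊆ t) :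
    ((Δ.facesOfCard k).filter fun r => ρ ⊆ r ∧ r ⊆ t).card = 2 := by
  have h1 : (t \ ρ).card = 2 := by rw [Finset.card_sdiff_of_subset hs]; omega
  rw [← h1]
  symm
  apply Finset.card_bij (fun x _ => insert x ρ)
  · intro x hx
    rw [Finset.mem_sdiff] at hx
    have hsub : insert x ρ ⊆ t := Finset.insert_subset hx.1 hs
    simp only [Finset.mem_filter, mem_foc]
    refine ⟨⟨Δ.down _ ht _ hsub, ?_⟩, by simp, hsub⟩
    rw [Finset.card_insert_of_notMem hx.2]; omega
  · intro a ha b hb hab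
    rw [Finset.mem_sdiff] at ha hb
    have : a ∈ insert b ρ := by rw [← hab]; simp
    rw [Finset.mem_insert] at this
    tauto
  · intro r hr
    simp only [Finset.mem_filter, mem_foc] at hr
    obtain ⟨⟨h2, h3⟩, h4, h5⟩ := hr
    have : (r \ ρ).card = 1 := by rw [Finset.card_sdiff_of_subset h4]; omega
    obtain ⟨x, hx⟩ := Finset.card_eq_one.mp this
    have hx' : x ∈ r \ ρ := by rw [hx]; simp
    rw [Finset.mem_sdiff] at hx'
    refine ⟨x, by simp [h5 hx'.1, hx'.2], ?_⟩
    rw [Finset.insert_eq, ← hx, Finset.sdiff_union_of_subset h4]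

lemma even_of_sum {α : Type*} (s : Finset α) (f : α → ℕ) (h2 : ∀ a ∈ s, f a ≤ 2)
    (he : Even (∑ a ∈ s, f a)) : Even (s.filter fun a => f a = 1).card := by
  have : ∑ a ∈ s, f a = (s.filter fun a => f a = 1).card + 2 * (s.filter fun a => f a = 2).card := by
    rw [Finset.card_filter, Finset.card_filter, Finset.mul_sum, ← Finset.sum_add_distrib]
    apply Finset.sum_congr rfl
    intro a ha
    have := h2 a ha
    split_ifs <;> omega
  rw [this] at he
  rw [Nat.even_iff] at he ⊢
  omega

lemma NPM.ridge {Δ : SComplex} {k : ℕ} (h : Δ.NPM k) {r : Finset ℕ} (hr : r ∈ Δ.faces)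
    (hc : r.card = k) : ((Δ.facesOfCard (k+1)).filter fun t => r ⊆ t).card = 2 := by
  rw [← h.2.2.1 r hr hc, facesOfCard, Finset.filter_filter]
  congr 1
  apply Finset.filter_congr
  intro x _; tauto

lemma NPM.parity {Δ : SComplex} {k : ℕ} (h : Δ.NPM k) {ρ : Finset ℕ} (hρ : ρ.card + 1 = k)
    {T : Finset (Finset ℕ)} (hT : T ⊆ Δ.facesOfCard (k+1)) :
    Even (((Δ.facesOfCard k).filter fun r => ρ ⊆ r ∧ (T.filter fun t => r ⊆ t).card = 1).card) := by
  rw [← Finset.filter_filter]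
  apply even_of_sum
  · intro r hr
    simp only [Finset.mem_filter, mem_foc] at hr
    rw [← h.ridge hr.1.1 hr.1.2]
    exact Finset.card_le_card (Finset.filter_subset_filter _ hT)
  · simp_rw [Finset.card_filter]
    rw [Finset.sum_comm]
    apply Finset.even_sum
    intro t ht
    have := hT ht
    rw [mem_foc] at this
    rw [← Finset.card_filter, Finset.filter_filter]
    by_cases hs : ρ ⊆ t
    · rw [card_between this.1 hρ this.2 hs]; exact even_two
    · rw [Finset.filter_false_of_mem]
      · simp
      · rintro x _ ⟨h1, h2⟩; exact hs (h1.trans h2)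

lemma mem_nb_of_face {Δ : SComplex} {σ : Finset ℕ} (h : σ ∈ Δ.faces) {x y : ℕ} (hx : x ∈ σ)
    (hy : y ∈ σ) (hxy : x ≠ y) : y ∈ Δ.nb x := by
  rw [mem_nb]
  refine ⟨hxy.symm, Δ.down _ h _ ?_⟩
  intro z hz; simp at hz; rcases hz with rfl | rfl <;> assumption

lemma NPM.separation {Δ : SComplex} {k : ℕ} (h : Δ.NPM k) (hk : 1 ≤ k) {X Y S : Finset ℕ}
    (hV : Δ.vertexSet ⊆ X ∪ Y ∪ S) (hXV : X ⊆ Δ.vertexSet) (hYV : Y ⊆ Δ.vertexSet)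
    (hX : X.Nonempty) (hY : Y.Nonempty) (hXS : Disjoint X S) (hYS : Disjoint Y S)
    (hXY : ∀ x ∈ X, ∀ y ∈ Y, y ∉ Δ.nb x) (hdis : Disjoint X Y) : k + 1 ≤ S.card := by
  by_contra hlt
  push Not at hlt
  have type2 : ∀ σ ∈ Δ.faces, ∀ x ∈ X, ∀ y ∈ Y, x ∈ σ → y ∈ σ → False := by
    intro σ hσ x hx y hy h1 h2
    refine hXY x hx y hy (mem_nb_of_face hσ h1 h2 ?_)
    rintro rfl; exact Finset.disjoint_left.mp hdis hx hy
  have type1 : ∀ σ ∈ Δ.faces, σ.card = k+1 → (∃ x ∈ X, x ∈ σ) ∨ (∃ y ∈ Y, y ∈ σ) := by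
    intro σ hσ hc
    by_contra hcon
    push Not at hcon
    have : σ ⊆ S := by
      intro z hz
      have := hV (mem_vs_of_mem hσ hz)
      simp only [Finset.mem_union] at this
      rcases this with (h1 | h1) | h1
      · exact absurd hz (hcon.1 z h1)
      · exact absurd hz (hcon.2 z h1)
      · exact h1
    have := Finset.card_le_card this
    omega
  obtain ⟨x0, hx0⟩ := hX
  obtain ⟨y0, hy0⟩ := hY
  obtain ⟨σ0, hσ0, hs0, hc0⟩ := h.2.1.2 {x0} (mem_vertexSet.mp (hXV hx0))
  obtain ⟨τ0, hτ0, ht0, hd0⟩ := h.2.1.2 {y0} (mem_vertexSet.mp (hYV hy0))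
  have hst : Δ.StronglyConnected k := by
    obtain ⟨j, rfl⟩ : ∃ j, k = j + 1 := ⟨k - 1, by omega⟩
    exact h.strong
  obtain ⟨σ, τ, ⟨hσ, hτ, cσ, cτ, cστ⟩, hσX, hτX⟩ := rtg_cross (p := fun s => ∃ x ∈ X, x ∈ s)
    (hst _ hσ0 _ hτ0 hc0 hd0) ⟨x0, hx0, hs0 (by simp)⟩ (by
      rintro ⟨x, hx, hxt⟩
      exact type2 _ hτ0 x hx y0 hy0 hxt (ht0 (by simp)))
  obtain ⟨x, hx, hxσ⟩ := hσX
  have hsub : σ ∩ τ ⊆ S := by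
    intro z hz
    rw [Finset.mem_inter] at hz
    have := hV (mem_vs_of_mem hσ hz.1)
    simp only [Finset.mem_union] at this
    rcases this with (h1 | h1) | h1
    · exact absurd ⟨z, h1, hz.2⟩ hτX
    · exact (type2 _ hσ x hx z h1 hxσ hz.1).elim
    · exact h1
  have hSeq : σ ∩ τ = S := Finset.eq_of_subset_of_card_le hsub (by omega)
  have hSc : S.card = k := by rw [← hSeq, cστ]
  have hSf : S ∈ Δ.faces := by rw [← hSeq]; exact Δ.down _ hσ _ Finset.inter_subset_left
  obtain ⟨s, hs⟩ : S.Nonempty := by rw [← Finset.card_pos]; omega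
  set T := (Δ.facesOfCard (k+1)).filter fun t => ∃ x ∈ X, x ∈ t with hTdef
  have hT : T ⊆ Δ.facesOfCard (k+1) := Finset.filter_subset _ _
  have hρ : (S.erase s).card + 1 = k := by rw [Finset.card_erase_of_mem hs]; omega
  have hpar := h.parity hρ hT
  have hone : ((Δ.facesOfCard k).filter fun r => S.erase s ⊆ r ∧ (T.filter fun t => r ⊆ t).card = 1)
      = {S} := by
    have hne : σ ≠ τ := by
      rintro rfl; rw [Finset.inter_self] at cστ; omega
    ext r
    simp only [Finset.mem_filter, mem_foc, Finset.mem_singleton]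
    constructor
    · rintro ⟨⟨hr, hrc⟩, hrs, hr1⟩
      by_contra hrS
      obtain ⟨z, hz, hzS⟩ : ∃ z ∈ r, z ∉ S := by
        by_contra hcon
        push Not at hcon
        exact hrS (Finset.eq_of_subset_of_card_le hcon (by omega))
      have := hV (mem_vs_of_mem hr hz)
      simp only [Finset.mem_union] at this
      rcases this with (h1 | h1) | h1
      · have : (T.filter fun t => r ⊆ t) = ((Δ.facesOfCard (k+1)).filter fun t => r ⊆ t) := by
          rw [hTdef, Finset.filter_filter]
          apply Finset.filter_congr
          intro t ht
          constructor
          · tauto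
          · intro h2; exact ⟨⟨z, h1, h2 hz⟩, h2⟩
        rw [this, h.ridge hr hrc] at hr1
        omega
      · have : (T.filter fun t => r ⊆ t) = ∅ := by
          rw [Finset.filter_eq_empty_iff]
          intro t ht hrt
          rw [hTdef, Finset.mem_filter, mem_foc] at ht
          obtain ⟨⟨h2, h3⟩, x', h4, h5⟩ := ht
          exact type2 _ h2 x' h4 z h1 h5 (hrt hz)
        rw [this] at hr1
        simp at hr1
      · exact hzS h1
    · rintro rfl
      refine ⟨⟨hSf, hSc⟩, Finset.erase_subset _ _, ?_⟩
      have hall : {σ, τ} = (Δ.facesOfCard (k+1)).filter fun t => r ⊆ t := by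
        apply Finset.eq_of_subset_of_card_le
        · intro t ht
          simp only [Finset.mem_insert, Finset.mem_singleton] at ht
          simp only [Finset.mem_filter, mem_foc]
          rcases ht with rfl | rfl
          · exact ⟨⟨hσ, cσ⟩, by rw [← hSeq]; exact Finset.inter_subset_left⟩
          · exact ⟨⟨hτ, cτ⟩, by rw [← hSeq]; exact Finset.inter_subset_right⟩
        · rw [h.ridge hSf hSc, Finset.card_pair hne]
      have : (T.filter fun t => r ⊆ t) = {σ} := by
        rw [hTdef, Finset.filter_comm, ← hall]
        ext t
        simp only [Finset.mem_filter, Finset.mem_insert, Finset.mem_singleton]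
        constructor
        · rintro ⟨rfl | rfl, h2⟩
          · rfl
          · exact absurd h2 hτX
        · rintro rfl; exact ⟨Or.inl rfl, x, hx, hxσ⟩
      rw [this]; simp
  rw [hone] at hpar
  simp at hpar

end SComplex

namespace SComplex

lemma edge_iff {Δ : SComplex} {e : Finset ℕ} {z : ℕ} (hz : z ∈ e) :
    e ∈ Δ.facesOfCard 2 ↔ ∃ w ∈ Δ.nb z, e = {z, w} := by
  rw [mem_foc]
  constructor
  · rintro ⟨h1, h2⟩
    have : (e.erase z).card = 1 := by rw [Finset.card_erase_of_mem hz, h2]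
    obtain ⟨w, hw⟩ := Finset.card_eq_one.mp this
    have he : e = {z, w} := by rw [← Finset.insert_erase hz, hw]
    refine ⟨w, ?_, he⟩
    rw [mem_nb, ← he]
    refine ⟨?_, h1⟩
    rintro rfl
    have : w ∈ e.erase w := by rw [hw]; simp
    simp at this
  · rintro ⟨w, hw, rfl⟩
    rw [mem_nb] at hw
    exact ⟨hw.2, Finset.card_pair hw.1.symm⟩

lemma pair_inj {z a b : ℕ} (h : ({z, a} : Finset ℕ) = {z, b}) : a = b := by
  have h1 : a ∈ ({z, b} : Finset ℕ) := by rw [← h]; simp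
  have h2 : b ∈ ({z, a} : Finset ℕ) := by rw [h]; simp
  simp at h1 h2
  omega

lemma touch_insert {Δ : SComplex} {R : Finset ℕ} {z : ℕ} (hz : z ∉ R) :
    Δ.touch (insert z R) = Δ.touch R + (Δ.nb z \ R).card := by
  have himg : (Δ.nb z \ R).card = ((Δ.nb z \ R).image fun w => ({z, w} : Finset ℕ)).card := by
    rw [Finset.card_image_of_injOn]
    intro a _ b _ hab
    exact pair_inj hab
  rw [himg, touch, touch, ← Finset.card_union_of_disjoint]
  · congr 1
    ext e
    simp only [Finset.mem_filter, Finset.mem_union, Finset.mem_image, Finset.mem_sdiff,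
      Finset.disjoint_insert_right]
    constructor
    · rintro ⟨h1, h2⟩
      by_cases h3 : Disjoint e R
      · have hze : z ∈ e := by tauto
        obtain ⟨w, hw, rfl⟩ := (edge_iff hze).mp h1
        refine Or.inr ⟨w, ⟨hw, ?_⟩, rfl⟩
        exact Finset.disjoint_left.mp h3 (by simp)
      · exact Or.inl ⟨h1, h3⟩
    · rintro (⟨h1, h2⟩ | ⟨w, ⟨h1, h2⟩, rfl⟩)
      · exact ⟨h1, by tauto⟩
      · exact ⟨(edge_iff (z := z) (by simp)).mpr ⟨w, h1, rfl⟩, by simp⟩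
  · rw [Finset.disjoint_left]
    intro e he he'
    simp only [Finset.mem_filter, Finset.mem_image, Finset.mem_sdiff] at he he'
    obtain ⟨w, ⟨h1, h2⟩, rfl⟩ := he'
    apply he.2
    simp [hz, h2]

lemma exc_insert {Δ : SComplex} {k : ℕ} {R : Finset ℕ} {z : ℕ} (hz : z ∉ R) :
    Δ.exc k (insert z R) = Δ.exc k R + (Δ.nb z \ R).card - (k + 1) := by
  rw [exc, exc, touch_insert hz, Finset.card_insert_of_notMem hz]
  push_cast; ring

lemma fVec_zero {Δ : SComplex} : Δ.fVec 0 = Δ.vertexSet.card := by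
  rw [fVec]
  symm
  apply Finset.card_bij (fun x _ => {x})
  · intro x hx; simpa using mem_vertexSet.mp hx
  · intro a _ b _ h; simpa using h
  · intro b hb
    simp only [Finset.mem_filter] at hb
    obtain ⟨x, rfl⟩ := Finset.card_eq_one.mp hb.2
    exact ⟨x, mem_vertexSet.mpr hb.1, rfl⟩

lemma fVec_one {Δ : SComplex} : Δ.fVec 1 = (Δ.facesOfCard 2).card := rfl

lemma touch_add {Δ : SComplex} (R : Finset ℕ) :
    Δ.touch R + ((Δ.facesOfCard 2).filter fun e => Disjoint e R).card = Δ.fVec 1 := by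
  rw [touch, fVec_one, add_comm]
  exact Finset.card_filter_add_card_filter_not _

lemma edges_in_le {Δ : SComplex} {R : Finset ℕ} :
    ((Δ.facesOfCard 2).filter fun e => Disjoint e R).card ≤ (Δ.vertexSet \ R).card.choose 2 := by
  rw [← Finset.card_powersetCard]
  apply Finset.card_le_card
  intro e he
  simp only [Finset.mem_filter, mem_foc] at he
  rw [Finset.mem_powersetCard]
  refine ⟨?_, he.1.2⟩
  intro x hx
  rw [Finset.mem_sdiff]
  exact ⟨mem_vs_of_mem he.1.1 hx, Finset.disjoint_left.mp he.2 hx⟩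

lemma choose_two_cast (n : ℕ) : ((n.choose 2 : ℕ) : ℤ) * 2 = n * (n - 1) := by
  induction n with
  | zero => simp
  | succ n ih =>
    rw [Nat.choose_succ_succ' n 1]; push_cast; rw [add_mul, ih]; simp; ring

lemma exc_formula {Δ : SComplex} {k : ℕ} {R : Finset ℕ} (hR : R ⊆ Δ.vertexSet) :
    Δ.exc k R = Δ.g2 k - (((Δ.facesOfCard 2).filter fun e => Disjoint e R).card
      - (k+1) * (Δ.vertexSet \ R).card + (k+2).choose 2) := by
  have h1 := touch_add (Δ := Δ) R
  have h2 := Finset.card_sdiff_add_card_eq_card hR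
  rw [exc, g2, fVec_zero, ← h1, ← h2]
  push_cast; ring

lemma g2_le_exc {Δ : SComplex} {k : ℕ} {R : Finset ℕ} (hR : R ⊆ Δ.vertexSet)
    (hc : (Δ.vertexSet \ R).card = k + 1) : Δ.g2 k ≤ Δ.exc k R := by
  rw [exc_formula hR, hc]
  have h1 := edges_in_le (Δ := Δ) (R := R)
  rw [hc] at h1
  have h2 := choose_two_cast (k+1)
  have h3 := choose_two_cast (k+2)
  zify at h1
  push_cast at *
  nlinarith

lemma exc_facet {Δ : SComplex} {k : ℕ} {σ : Finset ℕ} (hσ : σ ∈ Δ.faces) (hc : σ.card = k + 1) :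
    Δ.exc k (Δ.vertexSet \ σ) = Δ.g2 k := by
  rw [exc_formula Finset.sdiff_subset, Finset.sdiff_sdiff_eq_self (mem_vs_of_mem hσ), hc]
  have : ((Δ.facesOfCard 2).filter fun e => Disjoint e (Δ.vertexSet \ σ)) = σ.powersetCard 2 := by
    ext e
    simp only [Finset.mem_filter, mem_foc, Finset.mem_powersetCard]
    constructor
    · rintro ⟨⟨h1, h2⟩, h3⟩
      refine ⟨?_, h2⟩
      intro x hx
      by_contra hxs
      exact Finset.disjoint_left.mp h3 hx (by simp [mem_vs_of_mem h1 hx, hxs])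
    · rintro ⟨h1, h2⟩
      refine ⟨⟨Δ.down _ hσ _ h1, h2⟩, ?_⟩
      rw [Finset.disjoint_left]
      intro x hx; simp [h1 hx]
  rw [this, Finset.card_powersetCard, hc]
  have h2 := choose_two_cast (k+1)
  have h3 := choose_two_cast (k+2)
  push_cast at *
  nlinarith

lemma induced_g2 {Δ : SComplex} {k : ℕ} {W : Finset ℕ} (hW : W ⊆ Δ.vertexSet) :
    Δ.exc k (Δ.vertexSet \ W) = Δ.g2 k - (Δ.induced W).g2 k := by
  rw [exc_formula Finset.sdiff_subset, Finset.sdiff_sdiff_eq_self hW]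
  have hv : (Δ.induced W).vertexSet = W := by
    ext x
    rw [mem_vertexSet]
    simp only [induced, Finset.mem_filter, Finset.singleton_subset_iff, ← mem_vertexSet]
    constructor
    · tauto
    · intro h; exact ⟨hW h, h⟩
  have he : (Δ.induced W).facesOfCard 2 =
      ((Δ.facesOfCard 2).filter fun e => Disjoint e (Δ.vertexSet \ W)) := by
    ext e
    simp only [Finset.mem_filter, mem_foc, induced]
    constructor
    · rintro ⟨⟨h1, h2⟩, h3⟩
      refine ⟨⟨h1, h3⟩, ?_⟩
      rw [Finset.disjoint_left]
      intro x hx; simp [h2 hx]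
    · rintro ⟨⟨h1, h2⟩, h3⟩
      refine ⟨⟨h1, ?_⟩, h2⟩
      intro x hx
      by_contra hxs
      exact Finset.disjoint_left.mp h3 hx (by simp [mem_vs_of_mem h1 hx, hxs])
  rw [← he]
  conv_rhs => rw [g2, g2, fVec_zero, fVec_zero, fVec_one, fVec_one, hv]
  rw [g2, fVec_zero, fVec_one]

/-- the set of edges meeting `R` but not `R \ nb v` -/
lemma gain_aux {Δ : SComplex} {R : Finset ℕ} {v : ℕ} (hv : v ∉ R) :
    ((Δ.nb v ∩ R).image fun w => ({v, w} : Finset ℕ)) ∪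
      (((Δ.link {v}).facesOfCard 2).filter fun e => ¬ Disjoint e (Δ.nb v ∩ R)) ⊆
    ((Δ.facesOfCard 2).filter fun e => ¬ Disjoint e R ∧ Disjoint e (R \ Δ.nb v)) := by
  intro e he
  simp only [Finset.mem_union, Finset.mem_image, Finset.mem_filter, Finset.mem_inter] at he ⊢
  rcases he with ⟨w, ⟨h1, h2⟩, rfl⟩ | ⟨h1, h2⟩
  · refine ⟨(edge_iff (z := v) (by simp)).mpr ⟨w, h1, rfl⟩, ?_, ?_⟩
    · simp [h2]
    · simp [hv, h1]
  · rw [mem_foc, mem_link_singleton] at h1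
    refine ⟨?_, ?_, ?_⟩
    · rw [mem_foc]; exact ⟨Δ.down _ h1.1.2 _ (Finset.subset_insert _ _), h1.2⟩
    · intro hd; exact h2 (Finset.disjoint_of_subset_right Finset.inter_subset_right hd)
    · rw [Finset.disjoint_left]
      intro x hx hx'
      rw [Finset.mem_sdiff] at hx'
      apply hx'.2
      apply mem_nb_of_face h1.1.2 (by simp) (by simp [hx])
      rintro rfl; exact h1.1.1 hx

lemma gain_card {Δ : SComplex} {R : Finset ℕ} {v : ℕ} :
    (((Δ.nb v ∩ R).image fun w => ({v, w} : Finset ℕ)) ∪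
      (((Δ.link {v}).facesOfCard 2).filter fun e => ¬ Disjoint e (Δ.nb v ∩ R))).card =
    (Δ.nb v ∩ R).card + (Δ.link {v}).touch (Δ.nb v ∩ R) := by
  rw [Finset.card_union_of_disjoint, Finset.card_image_of_injOn, touch]
  · intro a _ b _ hab; exact pair_inj hab
  · rw [Finset.disjoint_left]
    intro e he he'
    simp only [Finset.mem_image, Finset.mem_filter, mem_foc, mem_link_singleton] at he he'
    obtain ⟨w, _, rfl⟩ := he
    apply he'.1.1.1; simp

lemma touch_split {Δ : SComplex} {R Q : Finset ℕ} (hQ : Q ⊆ R) :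
    Δ.touch R = Δ.touch Q +
      ((Δ.facesOfCard 2).filter fun e => ¬ Disjoint e R ∧ Disjoint e Q).card := by
  rw [touch, touch, ← Finset.card_union_of_disjoint]
  · congr 1
    ext e
    simp only [Finset.mem_filter, Finset.mem_union]
    have : Disjoint e R → Disjoint e Q := Finset.disjoint_of_subset_right hQ
    tauto
  · rw [Finset.disjoint_left]
    intro e he he'
    simp only [Finset.mem_filter] at he he'
    tauto

lemma exc_sdiff_nb {Δ : SComplex} {k : ℕ} {R : Finset ℕ} {v : ℕ} :
    Δ.exc (k+1) R - Δ.exc (k+1) (R \ Δ.nb v) - (Δ.link {v}).exc k (Δ.nb v ∩ R) =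
    ((Δ.facesOfCard 2).filter fun e => ¬ Disjoint e R ∧ Disjoint e (R \ Δ.nb v)).card -
    ((Δ.nb v ∩ R).card + (Δ.link {v}).touch (Δ.nb v ∩ R) : ℤ) := by
  have h1 := touch_split (Δ := Δ) (Finset.sdiff_subset : R \ Δ.nb v ⊆ R)
  have h2 : (R \ Δ.nb v).card + (Δ.nb v ∩ R).card = R.card := by
    rw [Finset.inter_comm]; exact Finset.card_sdiff_add_card_inter R (Δ.nb v)
  rw [exc, exc, exc, h1, ← h2]
  push_cast; ring

lemma gain {Δ : SComplex} {k : ℕ} {R : Finset ℕ} {v : ℕ} (hv : v ∉ R) :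
    Δ.exc (k+1) (R \ Δ.nb v) + (Δ.link {v}).exc k (Δ.nb v ∩ R) ≤ Δ.exc (k+1) R := by
  have h1 := exc_sdiff_nb (Δ := Δ) (k := k) (R := R) (v := v)
  have h2 := Finset.card_le_card (gain_aux (Δ := Δ) hv)
  rw [gain_card] at h2
  zify at h2
  linarith

lemma gain_eq {Δ : SComplex} {k : ℕ} {R : Finset ℕ} {v : ℕ} (hv : v ∉ R)
    (heq : Δ.exc (k+1) R ≤ Δ.exc (k+1) (R \ Δ.nb v) + (Δ.link {v}).exc k (Δ.nb v ∩ R))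
    {a b : ℕ} (ha : a ∈ Δ.nb v ∩ R) (hb : b ∈ Δ.nb v ∩ R) (hab : b ∈ Δ.nb a) :
    b ∈ (Δ.link {v}).nb a := by
  have h1 := exc_sdiff_nb (Δ := Δ) (k := k) (R := R) (v := v)
  have h3 : ((Δ.facesOfCard 2).filter fun e => ¬ Disjoint e R ∧ Disjoint e (R \ Δ.nb v)).card ≤ 
    (Δ.nb v ∩ R).card + (Δ.link {v}).touch (Δ.nb v ∩ R) := by zify; linarith
  rw [← gain_card] at h3
  have h4 := Finset.eq_of_subset_of_card_le (gain_aux (Δ := Δ) hv) h3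
  rw [Finset.mem_inter] at ha hb
  have h5 : ({a, b} : Finset ℕ) ∈ ((Δ.facesOfCard 2).filter
      fun e => ¬ Disjoint e R ∧ Disjoint e (R \ Δ.nb v)) := by
    simp only [Finset.mem_filter]
    refine ⟨(edge_iff (z := a) (by simp)).mpr ⟨b, hab, rfl⟩, by simp [ha.2], by simp [ha, hb]⟩
  rw [← h4] at h5
  simp only [Finset.mem_union, Finset.mem_image, Finset.mem_filter] at h5
  rcases h5 with ⟨w, _, h6⟩ | h6
  · exfalso
    have : v ∈ ({a, b} : Finset ℕ) := by rw [← h6]; simp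
    simp at this
    rcases this with rfl | rfl
    · exact hv ha.2
    · exact hv hb.2
  · rw [mem_foc] at h6
    rw [mem_nb]
    exact ⟨(mem_nb.mp hab).1, h6.1.1⟩

lemma submod {Δ : SComplex} {k : ℕ} (P Q : Finset ℕ) :
    Δ.exc k (P ∪ Q) + Δ.exc k (P ∩ Q) + ((Δ.facesOfCard 2).filter fun e =>
      ¬ Disjoint e (P \ Q) ∧ ¬ Disjoint e (Q \ P)).card = Δ.exc k P + Δ.exc k Q := by
  have h1 := Finset.card_union_add_card_inter P Q
  have h2 : Δ.touch (P ∪ Q) + Δ.touch (P ∩ Q) + ((Δ.facesOfCard 2).filter fun e =>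
      ¬ Disjoint e (P \ Q) ∧ ¬ Disjoint e (Q \ P)).card = Δ.touch P + Δ.touch Q := by
    simp only [touch, Finset.card_filter, ← Finset.sum_add_distrib]
    apply Finset.sum_congr rfl
    intro e he
    rw [mem_foc] at he
    obtain ⟨a, b, hab, rfl⟩ := Finset.card_eq_two.mp he.2
    simp only [Finset.disjoint_insert_left, Finset.disjoint_singleton_left, Finset.mem_union,
      Finset.mem_inter, Finset.mem_sdiff]
    by_cases a ∈ P <;> by_cases a ∈ Q <;> by_cases b ∈ P <;> by_cases b ∈ Q <;> simp [*]
  rw [exc, exc, exc, exc]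
  zify at h1 h2
  linear_combination h2 - (k+1) * h1

lemma touch_deg {Δ : SComplex} {m : ℕ} (K : Finset ℕ) (h : ∀ z ∈ K, m ≤ (Δ.nb z).card) :
    (m * K.card : ℤ) ≤ Δ.touch K + K.card.choose 2 := by
  induction K using Finset.induction_on with
  | empty => simp
  | insert z K hz ih =>
    have h1 := ih (fun x hx => h x (by simp [hx]))
    have h2 := h z (by simp)
    rw [touch_insert hz, Finset.card_insert_of_notMem hz]
    have h3 := Finset.card_le_card_sdiff_add_card (s := Δ.nb z) (t := K)
    rw [Nat.choose_succ_succ' K.card 1, Nat.choose_one_right]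
    zify at h2 h3
    push_cast
    linarith

end SComplex

namespace SComplex

/-- triangles of `Tf` sharing a free edge -/
def triRel (Ef Tf : Finset (Finset ℕ)) (t s : Finset ℕ) : Prop :=
  t ∈ Tf ∧ s ∈ Tf ∧ ∃ e ∈ Ef, e ⊆ t ∧ e ⊆ s

open Classical in
/-- class of a triangle -/
def triClass (Ef Tf : Finset (Finset ℕ)) (t : Finset ℕ) : Finset (Finset ℕ) :=
  Tf.filter fun s => Relation.ReflTransGen (triRel Ef Tf) t s

/-- all classes -/
def triClasses (Ef Tf : Finset (Finset ℕ)) : Finset (Finset (Finset ℕ)) :=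
  Tf.image (triClass Ef Tf)

lemma triRel_symm {Ef Tf : Finset (Finset ℕ)} {t s : Finset ℕ} (h : triRel Ef Tf t s) :
    triRel Ef Tf s t := by
  obtain ⟨h1, h2, e, h3, h4, h5⟩ := h
  exact ⟨h2, h1, e, h3, h5, h4⟩

lemma triRtg_symm {Ef Tf : Finset (Finset ℕ)} {t s : Finset ℕ}
    (h : Relation.ReflTransGen (triRel Ef Tf) t s) : Relation.ReflTransGen (triRel Ef Tf) s t := by
  induction h with
  | refl => exact .refl
  | tail _ h ih => exact Relation.ReflTransGen.head (triRel_symm h) ih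

lemma mem_triClass {Ef Tf : Finset (Finset ℕ)} {t s : Finset ℕ} :
    s ∈ triClass Ef Tf t ↔ s ∈ Tf ∧ Relation.ReflTransGen (triRel Ef Tf) t s := by
  simp [triClass]

lemma self_mem_triClass {Ef Tf : Finset (Finset ℕ)} {t : Finset ℕ} (ht : t ∈ Tf) :
    t ∈ triClass Ef Tf t := mem_triClass.mpr ⟨ht, .refl⟩

lemma triClass_eq {Ef Tf : Finset (Finset ℕ)} {t s : Finset ℕ}
    (h : s ∈ triClass Ef Tf t) : triClass Ef Tf s = triClass Ef Tf t := by
  rw [mem_triClass] at h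
  ext r
  rw [mem_triClass, mem_triClass]
  constructor
  · rintro ⟨h1, h2⟩; exact ⟨h1, h.2.trans h2⟩
  · rintro ⟨h1, h2⟩; exact ⟨h1, (triRtg_symm h.2).trans h2⟩

lemma sum_classes {Ef Tf : Finset (Finset ℕ)} (w : Finset ℕ → ℕ) :
    ∑ t ∈ Tf, w t = ∑ C ∈ triClasses Ef Tf, ∑ t ∈ C, w t := by
  rw [← Finset.sum_fiberwise_of_maps_to (s := Tf) (t := triClasses Ef Tf) (g := triClass Ef Tf)
    (fun t ht => Finset.mem_image_of_mem _ ht)]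
  apply Finset.sum_congr rfl
  intro C hC
  apply Finset.sum_congr _ (fun _ _ => rfl)
  obtain ⟨t, ht, rfl⟩ := Finset.mem_image.mp hC
  ext s
  rw [Finset.mem_filter]
  constructor
  · rintro ⟨h1, h2⟩; rw [← h2]; exact self_mem_triClass h1
  · intro h; exact ⟨(mem_triClass.mp h).1, triClass_eq h⟩

/-- incidence matrix -/
def inc (Ef Tf : Finset (Finset ℕ)) : Matrix ↥Tf ↥Ef (ZMod 2) :=
  fun t e => if (e : Finset ℕ) ⊆ (t : Finset ℕ) then 1 else 0

lemma ker_transpose {Ef Tf : Finset (Finset ℕ)}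
    (h2 : ∀ e ∈ Ef, (Tf.filter fun t => e ⊆ t).card = 2) :
    Module.finrank (ZMod 2) (LinearMap.ker (inc Ef Tf).transpose.mulVecLin) ≤
      (triClasses Ef Tf).card := by
  have hconst : ∀ f : ↥Tf → ZMod 2, (inc Ef Tf).transpose.mulVecLin f = 0 →
      ∀ t s : ↥Tf, Relation.ReflTransGen (triRel Ef Tf) t s → f t = f s := by
    intro f hf t s hts
    obtain ⟨t, ht⟩ := t
    obtain ⟨s, hs⟩ := s
    have step : ∀ t s (ht : t ∈ Tf) (hs : s ∈ Tf), triRel Ef Tf t s → f ⟨t, ht⟩ = f ⟨s, hs⟩ := by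
      rintro t s ht hs ⟨_, _, e, he, h3, h4⟩
      by_cases hne : t = s
      · subst hne; rfl
      have h5 := congrFun hf ⟨e, he⟩
      simp only [Matrix.mulVecLin_apply, Matrix.mulVec, dotProduct, Matrix.transpose_apply, inc,
        Pi.zero_apply, ite_mul, one_mul, zero_mul] at h5
      have h6 : (Tf.filter fun t => e ⊆ t) = {t, s} := by
        symm
        apply Finset.eq_of_subset_of_card_le
        · intro x hx; simp at hx; rw [Finset.mem_filter]
          rcases hx with rfl | rfl <;> simp [*]
        · rw [h2 e he, Finset.card_pair hne]
      have h7 : ∑ x : ↥Tf, (if e ⊆ (x : Finset ℕ) then f x else 0) = f ⟨t, ht⟩ + f ⟨s, hs⟩ := by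
        rw [← Finset.sum_filter]
        have : (Finset.univ.filter fun x : ↥Tf => e ⊆ (x : Finset ℕ)) = {⟨t, ht⟩, ⟨s, hs⟩} := by
          ext ⟨x, hx⟩
          have : x ∈ (Tf.filter fun t => e ⊆ t) ↔ x ∈ ({t, s} : Finset (Finset ℕ)) := by rw [h6]
          simp [hx] at this
          simp [this]
        rw [this, Finset.sum_pair]
        intro h; exact hne (by simpa using h)
      rw [h7] at h5
      exact CharTwo.add_eq_zero.mp h5
    change Relation.ReflTransGen (triRel Ef Tf) t s at hts
    have : ∀ s, Relation.ReflTransGen (triRel Ef Tf) t s → ∀ hs : s ∈ Tf,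
        f ⟨t, ht⟩ = f ⟨s, hs⟩ := by
      intro s hts
      induction hts with
      | refl => intro _; rfl
      | tail _ h ih => intro hs; rw [ih h.1]; exact step _ _ _ _ h
    exact this s hts hs
  have hrep : ∀ C : ↥(triClasses Ef Tf), ∃ t : ↥Tf, triClass Ef Tf t = C := by
    rintro ⟨C, hC⟩
    obtain ⟨t, ht, h⟩ := Finset.mem_image.mp hC
    exact ⟨⟨t, ht⟩, h⟩
  choose rep hr using hrep
  let L : (LinearMap.ker (inc Ef Tf).transpose.mulVecLin) →ₗ[ZMod 2] (↥(triClasses Ef Tf) → ZMod 2) :=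
    (LinearMap.funLeft (ZMod 2) (ZMod 2) rep).comp (Submodule.subtype _)
  have hL : Function.Injective L := by
    rw [← LinearMap.ker_eq_bot, LinearMap.ker_eq_bot']
    rintro ⟨f, hf⟩ h0
    rw [LinearMap.mem_ker] at hf
    ext ⟨t, ht⟩
    have h1 := congrFun h0 ⟨triClass Ef Tf t, Finset.mem_image_of_mem _ ht⟩
    have h2 := hr ⟨triClass Ef Tf t, Finset.mem_image_of_mem _ ht⟩
    simp only [Pi.zero_apply] at h1
    change f (rep _) = 0 at h1
    change f _ = 0
    rw [← h1]
    apply hconst f hf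
    have := self_mem_triClass (Ef := Ef) (rep ⟨triClass Ef Tf t, Finset.mem_image_of_mem _ ht⟩).2
    rw [h2] at this
    exact (mem_triClass.mp this).2
  have := LinearMap.finrank_le_finrank_of_injective hL
  simpa using this

lemma rank_bound {Ef Tf : Finset (Finset ℕ)}
    (h2 : ∀ e ∈ Ef, (Tf.filter fun t => e ⊆ t).card = 2) :
    Module.finrank (ZMod 2) (LinearMap.ker (inc Ef Tf).mulVecLin) + Tf.card ≤
      Ef.card + (triClasses Ef Tf).card := by
  have h1 := ker_transpose h2
  have h3 := LinearMap.finrank_range_add_finrank_ker (inc Ef Tf).transpose.mulVecLin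
  have h4 := LinearMap.finrank_range_add_finrank_ker (inc Ef Tf).mulVecLin
  have h5 := Matrix.rank_transpose (inc Ef Tf)
  rw [Matrix.rank, Matrix.rank] at h5
  simp only [Module.finrank_fintype_fun_eq_card, Fintype.card_coe] at h3 h4
  omega

lemma NPM.ineqE {Γ : SComplex} (h : Γ.NPM 2) {Ef Tf : Finset (Finset ℕ)}
    (hE : Ef ⊆ Γ.facesOfCard 2) (hT : Tf ⊆ Γ.facesOfCard 3)
    (hET : ∀ e ∈ Ef, ∀ t ∈ Γ.facesOfCard 3, e ⊆ t → t ∈ Tf) (I : Finset ℕ) (cls : ℕ → ℕ)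
    (hnf : ∀ e ∈ Γ.facesOfCard 2, e ∉ Ef → ∀ x ∈ e, ∀ y ∈ e,
      cls x = cls y ∨ (cls x ∉ I ∧ cls y ∉ I))
    (hI : ∀ i ∈ I, ∃ x ∈ Γ.vertexSet, cls x = i) (hout : ∃ x ∈ Γ.vertexSet, cls x ∉ I) :
    I.card + Tf.card ≤ Ef.card + (triClasses Ef Tf).card := by
  have h2 : ∀ e ∈ Ef, (Tf.filter fun t => e ⊆ t).card = 2 := by
    intro e he
    have he' := hE he
    rw [mem_foc] at he'
    rw [← h.ridge he'.1 he'.2]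
    congr 1
    ext t
    simp only [Finset.mem_filter]
    constructor
    · rintro ⟨h1, h2⟩; exact ⟨hT h1, h2⟩
    · rintro ⟨h1, h2⟩; exact ⟨hET e he t h1 h2, h2⟩
  refine le_trans ?_ (rank_bound h2)
  gcongr
  let ext : (↥I → ZMod 2) →ₗ[ZMod 2] (ℕ → ZMod 2) :=
    { toFun := fun f x => if hx : cls x ∈ I then f ⟨cls x, hx⟩ else 0
      map_add' := by intro f g; ext x; by_cases hx : cls x ∈ I <;> simp [hx]
      map_smul' := by intro f g; ext x; by_cases hx : cls x ∈ I <;> simp [hx] }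
  let D : (↥I → ZMod 2) →ₗ[ZMod 2] (↥Ef → ZMod 2) :=
    { toFun := fun f e => ∑ x ∈ (e : Finset ℕ), ext f x
      map_add' := by intro f g; ext x; simp [Finset.sum_add_distrib]
      map_smul' := by intro f g; ext x; simp [Finset.mul_sum] }
  have hzero : ∀ f, ∀ e ∈ Γ.facesOfCard 2, e ∉ Ef → ∑ x ∈ e, ext f x = 0 := by
    intro f e he hne
    have hc := he
    rw [mem_foc] at hc
    obtain ⟨a, b, hab, rfl⟩ := Finset.card_eq_two.mp hc.2
    rw [Finset.sum_pair hab]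
    have : ext f a = ext f b := by
      rcases hnf _ he hne a (by simp) b (by simp) with h1 | ⟨h1, h2⟩
      · simp [ext, h1]
      · simp [ext, h1, h2]
    rw [this]; exact CharTwo.add_self_eq_zero _
  have hker : ∀ f, D f ∈ LinearMap.ker (inc Ef Tf).mulVecLin := by
    intro f
    rw [LinearMap.mem_ker]
    ext ⟨t, ht⟩
    simp only [Matrix.mulVecLin_apply, Matrix.mulVec, dotProduct, inc, Pi.zero_apply, ite_mul,
      one_mul, zero_mul]
    have ht' := hT ht
    rw [mem_foc] at ht'
    have e1 : ∑ x : ↥Ef, (if (x : Finset ℕ) ⊆ t then (D f) x else 0) =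
        ∑ e ∈ Ef, if e ⊆ t then ∑ x ∈ e, ext f x else 0 := by
      rw [← Finset.sum_coe_sort Ef]; rfl
    have e2 : ∑ e ∈ Ef, (if e ⊆ t then ∑ x ∈ e, ext f x else 0) =
        ∑ e ∈ Γ.facesOfCard 2, if e ⊆ t then ∑ x ∈ e, ext f x else 0 := by
      apply Finset.sum_subset hE
      intro e he hne
      rw [hzero f e he hne]; simp
    have e3 : ∑ e ∈ Γ.facesOfCard 2, (if e ⊆ t then ∑ x ∈ e, ext f x else 0) =
        ∑ e ∈ t.powersetCard 2, ∑ x ∈ e, ext f x := by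
      rw [← Finset.sum_filter]
      apply Finset.sum_congr _ (fun _ _ => rfl)
      ext e
      simp only [Finset.mem_filter, mem_foc, Finset.mem_powersetCard]
      constructor
      · rintro ⟨⟨_, h1⟩, h2⟩; exact ⟨h2, h1⟩
      · rintro ⟨h1, h2⟩; exact ⟨⟨Γ.down _ ht'.1 _ h1, h2⟩, h1⟩
    rw [e1, e2, e3]
    obtain ⟨a, b, c, hab, hac, hbc, rfl⟩ := Finset.card_eq_three.mp ht'.2
    have e4 : ({a, b, c} : Finset ℕ).powersetCard 2 = {{a, b}, {a, c}, {b, c}} := by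
      symm
      apply Finset.eq_of_subset_of_card_le
      · intro e he
        simp only [Finset.mem_insert, Finset.mem_singleton] at he
        rw [Finset.mem_powersetCard]
        rcases he with rfl | rfl | rfl
        · exact ⟨by intro x; simp; tauto, Finset.card_pair hab⟩
        · exact ⟨by intro x; simp; tauto, Finset.card_pair hac⟩
        · exact ⟨by intro x; simp; tauto, Finset.card_pair hbc⟩
      · rw [Finset.card_powersetCard, ht'.2, Finset.card_eq_three.mpr]
        · decide
        · refine ⟨_, _, _, ?_, ?_, ?_, rfl⟩
          · intro h; exact hbc (pair_inj h)
          · intro h; rw [Finset.pair_comm a b] at h; exact hac (pair_inj h)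
          · intro h; rw [Finset.pair_comm a c, Finset.pair_comm b c] at h; exact hab (pair_inj h)
    have n1 : ({a, c} : Finset ℕ) ≠ {b, c} := by
      intro h; rw [Finset.pair_comm a c, Finset.pair_comm b c] at h; exact hab (pair_inj h)
    have n2 : ({a, b} : Finset ℕ) ∉ ({{a, c}, {b, c}} : Finset (Finset ℕ)) := by
      rw [Finset.mem_insert, Finset.mem_singleton]
      rintro (h | h)
      · exact hbc (pair_inj h)
      · rw [Finset.pair_comm a b] at h; exact hac (pair_inj h)
    rw [e4, Finset.sum_insert n2, Finset.sum_pair n1, Finset.sum_pair hab,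
      Finset.sum_pair hac, Finset.sum_pair hbc]
    have : ∀ p q r : ZMod 2, p + q + (p + r + (q + r)) = 0 := by decide
    exact this _ _ _
  have hinj : Function.Injective D := by
    rw [← LinearMap.ker_eq_bot, LinearMap.ker_eq_bot']
    intro f hf
    have hedge : ∀ x y, Γ.EdgeRel x y → ext f x = ext f y := by
      intro x y hxy
      have hm : ({x, y} : Finset ℕ) ∈ Γ.facesOfCard 2 := by
        rw [mem_foc]; exact ⟨hxy.2, Finset.card_pair hxy.1⟩
      have : ∑ z ∈ ({x, y} : Finset ℕ), ext f z = 0 := by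
        by_cases he : ({x, y} : Finset ℕ) ∈ Ef
        · exact congrFun hf ⟨_, he⟩
        · exact hzero f _ hm he
      rw [Finset.sum_pair hxy.1] at this
      exact CharTwo.add_eq_zero.mp this
    have hall : ∀ x ∈ Γ.vertexSet, ∀ y ∈ Γ.vertexSet, ext f x = ext f y := by
      intro x hx y hy
      have := (h.conn (by omega)).2 x hx y hy
      induction this with
      | refl => rfl
      | tail _ hbc ih => rw [ih (mem_vs_of_mem hbc.2 (by simp))]; exact hedge _ _ hbc
    obtain ⟨o, ho, hoI⟩ := hout
    ext ⟨i, hi⟩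
    obtain ⟨x, hx, rfl⟩ := hI i hi
    have := hall x hx o ho
    simpa [ext, hi, hoI] using this
  have := LinearMap.finrank_le_finrank_of_injective
    (f := LinearMap.codRestrict (LinearMap.ker (inc Ef Tf).mulVecLin) D hker) (by
      intro a b hab
      apply hinj
      exact congrArg Subtype.val hab)
  simpa using this

/-- number of non-free edges of a triangle -/
def wt (Γ : SComplex) (Ef : Finset (Finset ℕ)) (t : Finset ℕ) : ℕ :=
  ((Γ.facesOfCard 2).filter fun e => e ∉ Ef ∧ e ⊆ t).card

lemma NPM.three_tri {Γ : SComplex} (h : Γ.NPM 2) {Ef Tf : Finset (Finset ℕ)}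
    (hE : Ef ⊆ Γ.facesOfCard 2) (hT : Tf ⊆ Γ.facesOfCard 3)
    (hET : ∀ e ∈ Ef, ∀ t ∈ Γ.facesOfCard 3, e ⊆ t → t ∈ Tf) :
    3 * Tf.card = 2 * Ef.card + ∑ t ∈ Tf, Γ.wt Ef t := by
  have h1 : ∀ t ∈ Tf, (Ef.filter fun e => e ⊆ t).card + Γ.wt Ef t = 3 := by
    intro t ht
    have ht' := hT ht
    rw [mem_foc] at ht'
    have : t.powersetCard 2 = (Ef.filter fun e => e ⊆ t) ∪
        ((Γ.facesOfCard 2).filter fun e => e ∉ Ef ∧ e ⊆ t) := by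
      ext e
      simp only [Finset.mem_filter, mem_foc, Finset.mem_powersetCard, Finset.mem_union]
      constructor
      · rintro ⟨h1, h2⟩
        by_cases he : e ∈ Ef
        · exact Or.inl ⟨he, h1⟩
        · exact Or.inr ⟨⟨Γ.down _ ht'.1 _ h1, h2⟩, he, h1⟩
      · rintro (⟨h1, h2⟩ | ⟨h1, h2⟩)
        · have := hE h1
          rw [mem_foc] at this
          exact ⟨h2, this.2⟩
        · exact ⟨h2.2, h1.2⟩
    have hc := congrArg Finset.card this
    rw [Finset.card_union_of_disjoint, Finset.card_powersetCard, ht'.2] at hc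
    · rw [wt, ← hc]; decide
    · rw [Finset.disjoint_left]
      intro e he he'
      simp only [Finset.mem_filter] at he he'
      exact he'.2.1 he.1
  have h2 : ∑ t ∈ Tf, (Ef.filter fun e => e ⊆ t).card = ∑ e ∈ Ef, 2 := by
    simp_rw [Finset.card_filter]
    rw [Finset.sum_comm]
    apply Finset.sum_congr rfl
    intro e he
    have he' := hE he
    rw [mem_foc] at he'
    rw [← Finset.card_filter, ← h.ridge he'.1 he'.2]
    congr 1
    ext t
    simp only [Finset.mem_filter]
    constructor
    · rintro ⟨h1, h2⟩; exact ⟨hT h1, h2⟩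
    · rintro ⟨h1, h2⟩; exact ⟨hET e he t h1 h2, h2⟩
  have h3 := Finset.sum_congr rfl h1
  rw [Finset.sum_add_distrib, h2] at h3
  simp at h3
  omega

lemma NPM.ineqE' {Γ : SComplex} (h : Γ.NPM 2) {Ef Tf : Finset (Finset ℕ)}
    (hE : Ef ⊆ Γ.facesOfCard 2) (hT : Tf ⊆ Γ.facesOfCard 3)
    (hET : ∀ e ∈ Ef, ∀ t ∈ Γ.facesOfCard 3, e ⊆ t → t ∈ Tf) (I : Finset ℕ) (cls : ℕ → ℕ)
    (hnf : ∀ e ∈ Γ.facesOfCard 2, e ∉ Ef → ∀ x ∈ e, ∀ y ∈ e,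
      cls x = cls y ∨ (cls x ∉ I ∧ cls y ∉ I))
    (hI : ∀ i ∈ I, ∃ x ∈ Γ.vertexSet, cls x = i) (hout : ∃ x ∈ Γ.vertexSet, cls x ∉ I) :
    3 * I.card + ∑ t ∈ Tf, Γ.wt Ef t ≤ Ef.card + 3 * (triClasses Ef Tf).card := by
  have h1 := h.ineqE hE hT hET I cls hnf hI hout
  have h2 := h.three_tri hE hT hET
  omega

end SComplex

namespace SComplex

/-- boundary edges of a family of triangles -/
def bd (Γ : SComplex) (S : Finset (Finset ℕ)) : Finset (Finset ℕ) :=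
  (Γ.facesOfCard 2).filter fun e => (S.filter fun t => e ⊆ t).card = 1

lemma NPM.bd_even {Γ : SComplex} (h : Γ.NPM 2) {S : Finset (Finset ℕ)}
    (hS : S ⊆ Γ.facesOfCard 3) (v : ℕ) : Even ((Γ.bd S).filter fun e => v ∈ e).card := by
  have := h.parity (ρ := {v}) (by simp) hS
  rw [bd, Finset.filter_filter]
  convert this using 3
  simp [and_comm]

lemma three_le_of_even {B : Finset (Finset ℕ)} (h2 : ∀ e ∈ B, e.card = 2)
    (hev : ∀ v, Even (B.filter fun e => v ∈ e).card) (hne : B.Nonempty) : 3 ≤ B.card := by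
  obtain ⟨e0, he0⟩ := hne
  obtain ⟨a, b, hab, rfl⟩ := Finset.card_eq_two.mp (h2 e0 he0)
  have key : ∀ v ∈ ({a, b} : Finset ℕ), ∃ e ∈ B, e ≠ {a, b} ∧ v ∈ e := by
    intro v hv
    have hm : ({a, b} : Finset ℕ) ∈ B.filter fun e => v ∈ e := by
      rw [Finset.mem_filter]; exact ⟨he0, hv⟩
    have h1 : 1 < (B.filter fun e => v ∈ e).card := by
      have := hev v
      have hp : 0 < (B.filter fun e => v ∈ e).card := Finset.card_pos.mpr ⟨_, hm⟩
      rw [Nat.even_iff] at this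
      omega
    obtain ⟨e, he, hne⟩ := Finset.exists_mem_ne h1 {a, b}
    rw [Finset.mem_filter] at he
    exact ⟨e, he.1, hne, he.2⟩
  obtain ⟨e1, h1, n1, m1⟩ := key a (by simp)
  obtain ⟨e2, h3, n2, m2⟩ := key b (by simp)
  have n12 : e1 ≠ e2 := by
    rintro rfl
    apply n1
    symm
    apply Finset.eq_of_subset_of_card_le
    · intro x hx; simp at hx; rcases hx with rfl | rfl <;> assumption
    · rw [h2 _ h1, Finset.card_pair hab]
  have hc : ({{a, b}, e1, e2} : Finset (Finset ℕ)).card = 3 :=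
    Finset.card_eq_three.mpr ⟨_, _, _, n1.symm, n2.symm, n12, rfl⟩
  rw [← hc]
  apply Finset.card_le_card
  intro x hx
  simp only [Finset.mem_insert, Finset.mem_singleton] at hx
  rcases hx with rfl | rfl | rfl <;> assumption

lemma bd_card2 {Γ : SComplex} {S : Finset (Finset ℕ)} {e : Finset ℕ} (he : e ∈ Γ.bd S) :
    e ∈ Γ.faces ∧ e.card = 2 := by
  rw [bd, Finset.mem_filter, mem_foc] at he; exact he.1

lemma NPM.bd_nonempty {Γ : SComplex} (h : Γ.NPM 2) {S : Finset (Finset ℕ)}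
    (hS : S ⊆ Γ.facesOfCard 3) (hne : S.Nonempty) (hprop : S ≠ Γ.facesOfCard 3) :
    (Γ.bd S).Nonempty := by
  obtain ⟨s, hs⟩ := hne
  obtain ⟨t, ht, htS⟩ : ∃ t ∈ Γ.facesOfCard 3, t ∉ S := by
    by_contra hcon
    push Not at hcon
    exact hprop (Finset.Subset.antisymm hS hcon)
  have hs' := hS hs
  rw [mem_foc] at hs' ht
  obtain ⟨σ, τ, ⟨hσ, hτ, cσ, cτ, cc⟩, h1, h2⟩ := rtg_cross (p := fun x => x ∈ S)
    (NPM.strong (k := 1) h s hs'.1 t ht.1 hs'.2 ht.2) hs htS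
  refine ⟨σ ∩ τ, ?_⟩
  have hf : σ ∩ τ ∈ Γ.faces := Γ.down _ hσ _ Finset.inter_subset_left
  rw [bd, Finset.mem_filter, mem_foc]
  refine ⟨⟨hf, cc⟩, ?_⟩
  have hlt : (S.filter fun t => σ ∩ τ ⊆ t).card < 2 := by
    rw [← h.ridge hf cc]
    apply Finset.card_lt_card
    rw [Finset.ssubset_iff_of_subset (Finset.filter_subset_filter _ hS)]
    refine ⟨τ, ?_, ?_⟩
    · rw [Finset.mem_filter, mem_foc]; exact ⟨⟨hτ, cτ⟩, Finset.inter_subset_right⟩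
    · rw [Finset.mem_filter]; tauto
  have hpos : 0 < (S.filter fun t => σ ∩ τ ⊆ t).card :=
    Finset.card_pos.mpr ⟨σ, by rw [Finset.mem_filter]; exact ⟨h1, Finset.inter_subset_left⟩⟩
  omega

lemma NPM.class_bd {Γ : SComplex} (h : Γ.NPM 2) {Ef Tf : Finset (Finset ℕ)}
    (hT : Tf ⊆ Γ.facesOfCard 3)
    (hET : ∀ e ∈ Ef, ∀ t ∈ Γ.facesOfCard 3, e ⊆ t → t ∈ Tf) {t e : Finset ℕ}
    (he : e ∈ Γ.bd (triClass Ef Tf t)) : e ∉ Ef := by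
  intro heE
  rw [bd, Finset.mem_filter] at he
  obtain ⟨he1, he2⟩ := he
  rw [mem_foc] at he1
  obtain ⟨s, hs⟩ := Finset.card_eq_one.mp he2
  have hs' : s ∈ (triClass Ef Tf t).filter fun t => e ⊆ t := by rw [hs]; simp
  rw [Finset.mem_filter, mem_triClass] at hs'
  have : (Γ.facesOfCard 3).filter (fun t => e ⊆ t) ⊆ (triClass Ef Tf t).filter fun t => e ⊆ t := by
    intro r hr
    rw [Finset.mem_filter] at hr
    have hrT := hET e heE r hr.1 hr.2
    rw [Finset.mem_filter, mem_triClass]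
    exact ⟨⟨hrT, hs'.1.2.tail ⟨hs'.1.1, hrT, e, heE, hs'.2, hr.2⟩⟩, hr.2⟩
  have := Finset.card_le_card this
  rw [he2, h.ridge he1.1 he1.2] at this
  omega

lemma sum_wt {Γ : SComplex} {Ef S : Finset (Finset ℕ)} :
    ∑ t ∈ S, Γ.wt Ef t =
      ∑ e ∈ (Γ.facesOfCard 2).filter (fun e => e ∉ Ef), (S.filter fun t => e ⊆ t).card := by
  simp_rw [wt, ← Finset.filter_filter, Finset.card_filter]
  rw [Finset.sum_comm]

lemma triClass_sub {Γ : SComplex} {Ef Tf : Finset (Finset ℕ)} (hT : Tf ⊆ Γ.facesOfCard 3)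
    {t : Finset ℕ} : triClass Ef Tf t ⊆ Γ.facesOfCard 3 := by
  intro s hs; exact hT (mem_triClass.mp hs).1

lemma NPM.class_wt {Γ : SComplex} (h : Γ.NPM 2) {Ef Tf : Finset (Finset ℕ)}
    (hT : Tf ⊆ Γ.facesOfCard 3)
    (hET : ∀ e ∈ Ef, ∀ t ∈ Γ.facesOfCard 3, e ⊆ t → t ∈ Tf) {t : Finset ℕ} (ht : t ∈ Tf)
    (hne : triClass Ef Tf t ≠ Γ.facesOfCard 3) : 3 ≤ ∑ s ∈ triClass Ef Tf t, Γ.wt Ef s := by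
  have hsub := triClass_sub (Ef := Ef) (t := t) hT
  have h3 : 3 ≤ (Γ.bd (triClass Ef Tf t)).card :=
    three_le_of_even (fun e he => (bd_card2 he).2) (h.bd_even hsub)
      (h.bd_nonempty hsub ⟨t, self_mem_triClass ht⟩ hne)
  refine h3.trans ?_
  rw [sum_wt, Finset.card_eq_sum_ones]
  calc ∑ e ∈ Γ.bd (triClass Ef Tf t), 1
      = ∑ e ∈ Γ.bd (triClass Ef Tf t), ((triClass Ef Tf t).filter fun t => e ⊆ t).card := by
        apply Finset.sum_congr rfl
        intro e he
        rw [bd, Finset.mem_filter] at he; exact he.2.symm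
    _ ≤ _ := by
        apply Finset.sum_le_sum_of_subset
        intro e he
        rw [Finset.mem_filter]
        refine ⟨?_, h.class_bd hT hET he⟩
        rw [mem_foc]; exact bd_card2 he

/-- edges meeting R -/
def Efr (Γ : SComplex) (R : Finset ℕ) := (Γ.facesOfCard 2).filter fun e => ¬ Disjoint e R
/-- triangles meeting R -/
def Tfr (Γ : SComplex) (R : Finset ℕ) := (Γ.facesOfCard 3).filter fun e => ¬ Disjoint e R

lemma Tfr_sub {Γ : SComplex} {R : Finset ℕ} : Γ.Tfr R ⊆ Γ.facesOfCard 3 := Finset.filter_subset _ _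
lemma Efr_sub {Γ : SComplex} {R : Finset ℕ} : Γ.Efr R ⊆ Γ.facesOfCard 2 := Finset.filter_subset _ _

lemma Efr_Tfr {Γ : SComplex} {R : Finset ℕ} :
    ∀ e ∈ Γ.Efr R, ∀ t ∈ Γ.facesOfCard 3, e ⊆ t → t ∈ Γ.Tfr R := by
  intro e he t ht het
  rw [Efr, Finset.mem_filter] at he
  rw [Tfr, Finset.mem_filter]
  exact ⟨ht, fun hd => he.2 (Finset.disjoint_of_subset_left het hd)⟩

lemma not_Efr {Γ : SComplex} {R e : Finset ℕ} (h1 : e ∈ Γ.facesOfCard 2) (h2 : e ∉ Γ.Efr R) :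
    Disjoint e R := by
  rw [Efr, Finset.mem_filter] at h2
  tauto

lemma NPM.one_class {Γ : SComplex} (h : Γ.NPM 2) {R : Finset ℕ} {t : Finset ℕ}
    (ht : triClass (Γ.Efr R) (Γ.Tfr R) t = Γ.facesOfCard 3) :
    (triClasses (Γ.Efr R) (Γ.Tfr R)).card ≤ 1 ∧ ∑ s ∈ Γ.Tfr R, Γ.wt (Γ.Efr R) s =
      2 * ((Γ.facesOfCard 2).filter fun e => Disjoint e R).card := by
  have hTT : Γ.Tfr R = Γ.facesOfCard 3 := by
    apply Finset.Subset.antisymm Tfr_sub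
    rw [← ht]
    intro s hs; exact (mem_triClass.mp hs).1
  constructor
  · rw [Finset.card_le_one]
    intro a ha b hb
    obtain ⟨a, ha', rfl⟩ := Finset.mem_image.mp ha
    obtain ⟨b, hb', rfl⟩ := Finset.mem_image.mp hb
    have h1 : a ∈ triClass (Γ.Efr R) (Γ.Tfr R) t := by rw [ht]; exact Tfr_sub ha'
    have h2 : b ∈ triClass (Γ.Efr R) (Γ.Tfr R) t := by rw [ht]; exact Tfr_sub hb'
    rw [triClass_eq h1, triClass_eq h2]
  · rw [sum_wt, hTT, mul_comm, ← smul_eq_mul, ← Finset.sum_const]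
    apply Finset.sum_congr
    · apply Finset.filter_congr
      intro e he
      rw [Efr, Finset.mem_filter]; tauto
    · intro e he
      rw [Finset.mem_filter, mem_foc] at he
      exact h.ridge he.1.1 he.1.2

lemma NPM.P2_basic {Γ : SComplex} (h : Γ.NPM 2) {R : Finset ℕ} (hR : R ⊆ Γ.vertexSet)
    (hA : (Γ.vertexSet \ R).Nonempty) :
    3 * R.card + ∑ t ∈ Γ.Tfr R, Γ.wt (Γ.Efr R) t ≤
      Γ.touch R + 3 * (triClasses (Γ.Efr R) (Γ.Tfr R)).card := by
  obtain ⟨z, hz⟩ := hA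
  rw [Finset.mem_sdiff] at hz
  refine h.ineqE' Efr_sub Tfr_sub Efr_Tfr R id ?_ ?_ ⟨z, hz⟩
  · intro e he hne x hx y hy
    have := not_Efr he hne
    right
    exact ⟨Finset.disjoint_left.mp this hx, Finset.disjoint_left.mp this hy⟩
  · intro i hi; exact ⟨i, hR hi, rfl⟩

lemma NPM.P2_full {Γ : SComplex} (h : Γ.NPM 2) {R : Finset ℕ} (hR : R ⊆ Γ.vertexSet)
    (hA : (Γ.vertexSet \ R).Nonempty)
    (he : 2 ≤ ((Γ.facesOfCard 2).filter fun e => Disjoint e R).card) {t : Finset ℕ}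
    (ht : triClass (Γ.Efr R) (Γ.Tfr R) t = Γ.facesOfCard 3) : 1 ≤ Γ.exc 2 R := by
  have h1 := h.P2_basic hR hA
  have h2 := h.one_class ht
  rw [exc]; push_cast
  omega

lemma NPM.P2 {Γ : SComplex} (h : Γ.NPM 2) {R : Finset ℕ} (hR : R ⊆ Γ.vertexSet)
    (hA : 3 ≤ (Γ.vertexSet \ R).card) : 0 ≤ Γ.exc 2 R := by
  have hAne : (Γ.vertexSet \ R).Nonempty := by rw [← Finset.card_pos]; omega
  by_cases hcl : ∃ t, triClass (Γ.Efr R) (Γ.Tfr R) t = Γ.facesOfCard 3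
  · obtain ⟨t, ht⟩ := hcl
    by_cases he : 2 ≤ ((Γ.facesOfCard 2).filter fun e => Disjoint e R).card
    · have := h.P2_full hR hAne he ht; omega
    · obtain ⟨B, a, haB, hBA, hB2, hBe⟩ : ∃ B : Finset ℕ, ∃ a, a ∈ B ∧ B ⊆ Γ.vertexSet \ R ∧
          B.card ≤ 2 ∧ ∀ e ∈ Γ.facesOfCard 2, Disjoint e R → e ⊆ B := by
        rcases Finset.eq_empty_or_nonempty ((Γ.facesOfCard 2).filter fun e => Disjoint e R) with
          h0 | ⟨e, hee⟩
        · obtain ⟨a, ha⟩ := hAne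
          refine ⟨{a}, a, by simp, by simpa using ha, by simp, ?_⟩
          intro e he hd
          have : e ∈ ((Γ.facesOfCard 2).filter fun e => Disjoint e R) := by simp [he, hd]
          rw [h0] at this; simp at this
        · have hee' := hee
          rw [Finset.mem_filter, mem_foc] at hee'
          obtain ⟨a, ha⟩ : e.Nonempty := by rw [← Finset.card_pos]; omega
          refine ⟨e, a, ha, ?_, by omega, ?_⟩
          · intro x hx
            rw [Finset.mem_sdiff]
            exact ⟨mem_vs_of_mem hee'.1.1 hx, Finset.disjoint_left.mp hee'.2 hx⟩
          · intro e' he' hd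
            have : ((Γ.facesOfCard 2).filter fun e => Disjoint e R).card ≤ 1 := by omega
            rw [Finset.card_le_one] at this
            rw [this e' (by simp [he', hd]) e hee]
      obtain ⟨z, hz, hzB⟩ : ∃ z ∈ Γ.vertexSet \ R, z ∉ B := by
        by_contra hcon
        push Not at hcon
        have := Finset.card_le_card hcon
        omega
      have haA := hBA haB
      rw [Finset.mem_sdiff] at haA hz
      have h1 := h.ineqE' (Efr_sub (R := R)) Tfr_sub Efr_Tfr (insert a R)
        (fun x => if x ∈ B then a else x) ?_ ?_ ?_
      · rw [Finset.card_insert_of_notMem haA.2] at h1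
        have h2 := h.one_class ht
        have h3 : (Γ.Efr R).card = Γ.touch R := rfl
        rw [exc]; push_cast
        omega
      · intro e he hne x hx y hy
        have := hBe e he (not_Efr he hne)
        left
        simp [this hx, this hy]
      · intro i hi
        rw [Finset.mem_insert] at hi
        rcases hi with rfl | hi
        · exact ⟨i, haA.1, by simp⟩
        · refine ⟨i, hR hi, ?_⟩
          have : i ∉ B := fun hiB => (Finset.mem_sdiff.mp (hBA hiB)).2 hi
          simp [this]
      · refine ⟨z, hz.1, ?_⟩
        simp only [hzB, if_false, Finset.mem_insert, not_or]
        exact ⟨by rintro rfl; exact hzB haB, hz.2⟩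
  · push Not at hcl
    have h1 := h.P2_basic hR hAne
    rw [sum_classes (Ef := Γ.Efr R)] at h1
    have h2 : 3 * (triClasses (Γ.Efr R) (Γ.Tfr R)).card ≤
        ∑ C ∈ triClasses (Γ.Efr R) (Γ.Tfr R), ∑ t ∈ C, Γ.wt (Γ.Efr R) t := by
      rw [mul_comm, ← smul_eq_mul, ← Finset.sum_const]
      apply Finset.sum_le_sum
      intro C hC
      obtain ⟨t, ht, rfl⟩ := Finset.mem_image.mp hC
      exact h.class_wt Tfr_sub Efr_Tfr ht (hcl t)
    rw [exc]; push_cast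
    omega

end SComplex

namespace SComplex

lemma NPM.star_conn {Γ : SComplex} (h : Γ.NPM 2) {Ef Tf : Finset (Finset ℕ)} {a : ℕ}
    (hE : ∀ e ∈ Γ.facesOfCard 2, a ∈ e → e ∈ Ef) (hT : ∀ t ∈ Γ.facesOfCard 3, a ∈ t → t ∈ Tf)
    {t s : Finset ℕ} (ht : t ∈ Γ.facesOfCard 3) (hs : s ∈ Γ.facesOfCard 3) (hat : a ∈ t)
    (has : a ∈ s) : Relation.ReflTransGen (triRel Ef Tf) t s := by
  rw [mem_foc] at ht hs
  have ha : {a} ∈ Γ.faces := Γ.down _ ht.1 _ (by simpa using hat)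
  have h1 := NPM.strong (k := 0) (NPM.link (k := 1) h ha) (t.erase a)
    (by rw [mem_link_singleton]; simp [Finset.insert_erase hat, ht])
    (s.erase a) (by rw [mem_link_singleton]; simp [Finset.insert_erase has, hs])
    (by rw [Finset.card_erase_of_mem hat]; omega) (by rw [Finset.card_erase_of_mem has]; omega)
  have h2 := Relation.ReflTransGen.lift (p := triRel Ef Tf) (fun s => insert a s) ?_ _ _ h1
  · simpa [Function.onFun, Finset.insert_erase hat, Finset.insert_erase has] using h2
  · rintro p q ⟨hp, hq, cp, cq, cpq⟩
    rw [mem_link_singleton] at hp hq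
    refine ⟨?_, ?_, insert a (p ∩ q), ?_, ?_, ?_⟩
    · apply hT _ _ (by simp)
      rw [mem_foc]; refine ⟨hp.2, ?_⟩
      rw [Finset.card_insert_of_notMem hp.1]; omega
    · apply hT _ _ (by simp)
      rw [mem_foc]; refine ⟨hq.2, ?_⟩
      rw [Finset.card_insert_of_notMem hq.1]; omega
    · apply hE _ _ (by simp)
      rw [mem_foc]
      refine ⟨Γ.down _ hp.2 _ (Finset.insert_subset_insert _ Finset.inter_subset_left), ?_⟩
      rw [Finset.card_insert_of_notMem (by simp [hp.1])]; omega
    · exact Finset.insert_subset_insert _ Finset.inter_subset_left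
    · exact Finset.insert_subset_insert _ Finset.inter_subset_right

lemma NPM.L2 {Γ : SComplex} (h : Γ.NPM 2) {Z : Finset ℕ} (hZ : Z ⊆ Γ.vertexSet)
    (hA : (Γ.vertexSet \ Z).Nonempty)
    (he : 2 ≤ ((Γ.facesOfCard 2).filter fun e => Disjoint e Z).card)
    (hexc : Γ.exc 2 Z ≤ 0) {K : Finset ℕ} (hKZ : K ⊆ Z) (hK5 : K.card = 5)
    (hcl : ∀ a ∈ K, ∀ b ∈ K, a ≠ b → b ∈ Γ.nb a) : False := by
  have hnoT : ∀ t, triClass (Γ.Efr Z) (Γ.Tfr Z) t ≠ Γ.facesOfCard 3 := by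
    intro t ht
    have := h.P2_full hZ hA he ht
    omega
  set Ef := (Γ.Efr Z).filter fun e => ¬ e ⊆ K with hEf
  set Tf := (Γ.Tfr Z).filter fun e => ¬ e ⊆ K with hTf
  have hE : Ef ⊆ Γ.facesOfCard 2 := (Finset.filter_subset _ _).trans Efr_sub
  have hT : Tf ⊆ Γ.facesOfCard 3 := (Finset.filter_subset _ _).trans Tfr_sub
  have hET : ∀ e ∈ Ef, ∀ t ∈ Γ.facesOfCard 3, e ⊆ t → t ∈ Tf := by
    intro e he t ht het
    rw [hEf, Finset.mem_filter] at he
    rw [hTf, Finset.mem_filter]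
    exact ⟨Efr_Tfr e he.1 t ht het, fun htK => he.2 (het.trans htK)⟩
  have hnE : ∀ e ∈ Γ.facesOfCard 2, e ∉ Ef → Disjoint e Z ∨ e ⊆ K := by
    intro e he hne
    by_contra hcon
    push Not at hcon
    apply hne
    rw [hEf, Finset.mem_filter, Efr, Finset.mem_filter]
    tauto
  obtain ⟨a, haK⟩ : K.Nonempty := by rw [← Finset.card_pos]; omega
  obtain ⟨z, hz⟩ := hA
  rw [Finset.mem_sdiff] at hz
  have hnK : ∀ x, x ∉ Z → x ∉ K := fun x hx hxK => hx (hKZ hxK)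
  have h1 := h.ineqE' hE hT hET (insert a (Z \ K)) (fun x => if x ∈ K then a else x) ?_ ?_ ?_
  rotate_left
  · intro e he hne x hx y hy
    rcases hnE e he hne with hd | hs
    · right
      have key : ∀ x ∈ e, (if x ∈ K then a else x) ∉ insert a (Z \ K) := by
        intro x hx
        have hxZ := Finset.disjoint_left.mp hd hx
        simp only [hnK x hxZ, if_false, Finset.mem_insert, Finset.mem_sdiff, not_or]
        exact ⟨by rintro rfl; exact hxZ (hKZ haK), by tauto⟩
      exact ⟨key x hx, key y hy⟩
    · left; simp [hs hx, hs hy]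
  · intro i hi
    rw [Finset.mem_insert, Finset.mem_sdiff] at hi
    rcases hi with rfl | hi
    · exact ⟨i, hZ (hKZ haK), by simp⟩
    · exact ⟨i, hZ hi.1, by simp [hi.2]⟩
  · refine ⟨z, hz.1, ?_⟩
    simp only [hnK z hz.2, if_false, Finset.mem_insert, Finset.mem_sdiff, not_or]
    exact ⟨by rintro rfl; exact hz.2 (hKZ haK), by tauto⟩
  -- counting free edges
  have hEc : Ef.card + 10 = Γ.touch Z := by
    have h2 : (Γ.Efr Z).filter (fun e => e ⊆ K) = K.powersetCard 2 := by
      ext e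
      rw [Finset.mem_filter, Efr, Finset.mem_filter, mem_foc, Finset.mem_powersetCard]
      constructor
      · tauto
      · rintro ⟨h2, h3⟩
        obtain ⟨x, y, hxy, rfl⟩ := Finset.card_eq_two.mp h3
        have hx : x ∈ K := h2 (by simp)
        have hy : y ∈ K := h2 (by simp)
        refine ⟨⟨⟨(mem_nb.mp (hcl x hx y hy hxy)).2, h3⟩, ?_⟩, h2⟩
        simp [hKZ hx]
    have h3 := Finset.card_filter_add_card_filter_not (s := Γ.Efr Z) (fun e => e ⊆ K)
    rw [h2, Finset.card_powersetCard, hK5] at h3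
    have h5 : Nat.choose 5 2 = 10 := rfl
    rw [h5, add_comm] at h3
    have h4 : (Γ.Efr Z).card = Γ.touch Z := rfl
    rw [← h4, ← h3, hEf]
  have hIc : (insert a (Z \ K)).card + 4 = Z.card := by
    rw [Finset.card_insert_of_notMem (by simp [haK]), Finset.card_sdiff_of_subset hKZ]
    have := Finset.card_le_card hKZ
    omega
  have hup : ∑ t ∈ Tf, Γ.wt Ef t ≤ 2 + 3 * (triClasses Ef Tf).card := by
    rw [exc] at hexc
    push_cast at hexc
    omega
  -- classes are inside old classes
  have hmono : ∀ t, triClass Ef Tf t ⊆ triClass (Γ.Efr Z) (Γ.Tfr Z) t := by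
    intro t s hs
    rw [mem_triClass] at hs ⊢
    refine ⟨(Finset.mem_filter.mp hs.1).1, Relation.ReflTransGen.mono ?_ _ _ hs.2⟩
    rintro p q ⟨hp, hq, e, he, h1, h2⟩
    exact ⟨(Finset.mem_filter.mp hp).1, (Finset.mem_filter.mp hq).1, e, (Finset.mem_filter.mp he).1,
      h1, h2⟩
  have hne : ∀ t, triClass Ef Tf t ≠ Γ.facesOfCard 3 := by
    intro t ht
    apply hnoT t
    apply Finset.Subset.antisymm (triClass_sub Tfr_sub)
    rw [← ht]; exact hmono t
  have h3 : ∀ C ∈ triClasses Ef Tf, 3 ≤ ∑ t ∈ C, Γ.wt Ef t := by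
    intro C hC
    obtain ⟨t, ht, rfl⟩ := Finset.mem_image.mp hC
    exact h.class_wt hT hET ht (hne t)
  -- a class of weight at least six
  have hsix : ∃ C ∈ triClasses Ef Tf, 6 ≤ ∑ t ∈ C, Γ.wt Ef t := by
    have haZ := hKZ haK
    obtain ⟨t0, ht0, hat0, ct0⟩ := h.2.1.2 {a} (mem_vertexSet.mp (hZ haZ))
    have hat0' : a ∈ t0 := hat0 (by simp)
    have ht0T : t0 ∈ Γ.facesOfCard 3 := by rw [mem_foc]; exact ⟨ht0, ct0⟩
    have ht0f : t0 ∈ Γ.Tfr Z := by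
      rw [Tfr, Finset.mem_filter]
      exact ⟨ht0T, fun hd => Finset.disjoint_left.mp hd hat0' haZ⟩
    set C1 := triClass (Γ.Efr Z) (Γ.Tfr Z) t0 with hC1
    have hC1s : C1 ⊆ Γ.facesOfCard 3 := triClass_sub Tfr_sub
    obtain ⟨α, hα⟩ := h.bd_nonempty hC1s ⟨t0, self_mem_triClass ht0f⟩ (hnoT t0)
    have hαE := h.class_bd Tfr_sub Efr_Tfr hα
    have hα2 := bd_card2 hα
    have hαZ : Disjoint α Z := not_Efr (mem_foc.mpr hα2) hαE
    have hα1 : (C1.filter fun t => α ⊆ t).card = 1 := (Finset.mem_filter.mp hα).2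
    obtain ⟨t1, ht1⟩ := Finset.card_pos.mp (by rw [hα1]; omega : 0 < (C1.filter fun t => α ⊆ t).card)
    rw [Finset.mem_filter] at ht1
    obtain ⟨ht1C, hαt⟩ := ht1
    obtain ⟨ht1f, ht1r⟩ := mem_triClass.mp ht1C
    obtain ⟨p, hp⟩ : α.Nonempty := by rw [← Finset.card_pos]; omega
    have ht1Tf : t1 ∈ Tf := by
      rw [hTf, Finset.mem_filter]
      refine ⟨ht1f, fun hs => ?_⟩
      exact hnK p (Finset.disjoint_left.mp hαZ hp) (hs (hαt hp))
    set S := triClass Ef Tf t1 with hS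
    have hSs : S ⊆ Γ.facesOfCard 3 := triClass_sub hT
    have hC1' : triClass (Γ.Efr Z) (Γ.Tfr Z) t1 = C1 := triClass_eq ht1C
    have hSC : S ⊆ C1 := by rw [← hC1']; exact hmono t1
    refine ⟨S, Finset.mem_image_of_mem _ ht1Tf, ?_⟩
    have hbdS : ∀ e ∈ Γ.bd S, Disjoint e Z ∨ e ⊆ K := fun e he =>
      hnE e (mem_foc.mpr (bd_card2 he)) (h.class_bd hT hET he)
    have hexcl : ∀ e : Finset ℕ, e.card = 2 → Disjoint e Z → e ⊆ K → False := by
      intro e h2 hd hs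
      obtain ⟨x, hx⟩ : e.Nonempty := by rw [← Finset.card_pos]; omega
      exact Finset.disjoint_left.mp hd hx (hKZ (hs hx))
    have hαS : α ∈ Γ.bd S := by
      rw [bd, Finset.mem_filter]
      refine ⟨mem_foc.mpr hα2, le_antisymm ?_ ?_⟩
      · rw [← hα1]; exact Finset.card_le_card (Finset.filter_subset_filter _ hSC)
      · rw [Nat.succ_le_iff, Finset.card_pos]
        exact ⟨t1, by rw [Finset.mem_filter]; exact ⟨self_mem_triClass ht1Tf, hαt⟩⟩
    -- A part
    have hApart : 3 ≤ ((Γ.bd S).filter fun e => Disjoint e Z).card := by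
      apply three_le_of_even
      · intro e he; exact (bd_card2 (Finset.mem_filter.mp he).1).2
      · intro v
        by_cases hv : v ∈ Z
        · rw [Finset.filter_eq_empty_iff.mpr]
          · simp
          · intro e he hve
            exact Finset.disjoint_left.mp (Finset.mem_filter.mp he).2 hve hv
        · convert h.bd_even hSs v using 2
          rw [Finset.filter_filter]
          apply Finset.filter_congr
          intro e he
          constructor
          · tauto
          · intro hve
            refine ⟨?_, hve⟩
            rcases hbdS e he with h5 | h5
            · exact h5
            · exact absurd (h5 hve) (hnK v hv)
      · exact ⟨α, by rw [Finset.mem_filter]; exact ⟨hαS, hαZ⟩⟩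
    have hKpart : 3 ≤ ∑ e ∈ (Γ.facesOfCard 2).filter (fun e => e ⊆ K),
        (S.filter fun t => e ⊆ t).card := by
      rcases Finset.eq_empty_or_nonempty ((Γ.bd S).filter fun e => e ⊆ K) with h0 | hne0
      · -- S = C1
        have hclosed : ∀ t, Relation.ReflTransGen (triRel (Γ.Efr Z) (Γ.Tfr Z)) t1 t → t ∈ S := by
          intro t ht
          induction ht with
          | refl => exact self_mem_triClass ht1Tf
          | tail _ hbc ih =>
            rename_i q r _
            obtain ⟨hq, hr, e, he, heq, her⟩ := hbc
            have heE := Efr_sub he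
            have heE' := mem_foc.mp heE
            by_cases heK : e ⊆ K
            · have hnb : e ∉ Γ.bd S := by
                intro hb
                have : e ∈ (Γ.bd S).filter fun e => e ⊆ K := by rw [Finset.mem_filter]; exact ⟨hb, heK⟩
                rw [h0] at this; simp at this
              rw [bd, Finset.mem_filter] at hnb
              have hn1 : (S.filter fun t => e ⊆ t).card ≠ 1 := by tauto
              have hpos : 0 < (S.filter fun t => e ⊆ t).card :=
                Finset.card_pos.mpr ⟨q, by rw [Finset.mem_filter]; exact ⟨ih, heq⟩⟩
              have heqq := Finset.eq_of_subset_of_card_le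
                (Finset.filter_subset_filter (fun t => e ⊆ t) hSs)
                (by rw [h.ridge heE'.1 heE'.2]; omega)
              have : r ∈ (Γ.facesOfCard 3).filter fun t => e ⊆ t := by
                rw [Finset.mem_filter]; exact ⟨Tfr_sub hr, her⟩
              rw [← heqq, Finset.mem_filter] at this
              exact this.1
            · have heEf : e ∈ Ef := by rw [hEf, Finset.mem_filter]; exact ⟨he, heK⟩
              have hrT := hET e heEf r (Tfr_sub hr) her
              rw [hS, mem_triClass] at ih ⊢
              exact ⟨hrT, ih.2.tail ⟨ih.1, hrT, e, heEf, heq, her⟩⟩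
        have hatri : ∀ t ∈ Γ.facesOfCard 3, a ∈ t → t ∈ S := by
          intro t ht hat
          apply hclosed
          refine (triRtg_symm ht1r).trans ?_
          apply h.star_conn _ _ ht0T ht hat0' hat
          · intro e he hae; rw [Efr, Finset.mem_filter]
            exact ⟨he, fun hd => Finset.disjoint_left.mp hd hae haZ⟩
          · intro e he hae; rw [Tfr, Finset.mem_filter]
            exact ⟨he, fun hd => Finset.disjoint_left.mp hd hae haZ⟩
        have hcard : ((K.erase a).image fun c => ({a, c} : Finset ℕ)).card = 4 := by
          rw [Finset.card_image_of_injOn, Finset.card_erase_of_mem haK, hK5]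
          intro p _ q _ hpq; exact pair_inj hpq
        calc 3 ≤ ((K.erase a).image fun c => ({a, c} : Finset ℕ)).card := by omega
          _ = ∑ e ∈ (K.erase a).image fun c => ({a, c} : Finset ℕ), 1 := Finset.card_eq_sum_ones _
          _ ≤ ∑ e ∈ (K.erase a).image fun c => ({a, c} : Finset ℕ),
                (S.filter fun t => e ⊆ t).card := by
              apply Finset.sum_le_sum
              intro e he
              obtain ⟨c, hc, rfl⟩ := Finset.mem_image.mp he
              rw [Finset.mem_erase] at hc
              have hf := (mem_nb.mp (hcl a haK c hc.2 hc.1.symm)).2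
              obtain ⟨t, ht, hst, hct⟩ := h.2.1.2 _ hf
              rw [Nat.succ_le_iff, Finset.card_pos]
              refine ⟨t, ?_⟩
              rw [Finset.mem_filter]
              exact ⟨hatri t (mem_foc.mpr ⟨ht, hct⟩) (hst (by simp)), hst⟩
          _ ≤ _ := by
              apply Finset.sum_le_sum_of_subset
              intro e he
              obtain ⟨c, hc, rfl⟩ := Finset.mem_image.mp he
              rw [Finset.mem_erase] at hc
              have hf := (mem_nb.mp (hcl a haK c hc.2 hc.1.symm)).2
              rw [Finset.mem_filter, mem_foc]
              refine ⟨⟨hf, Finset.card_pair hc.1.symm⟩, ?_⟩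
              intro x hx; simp at hx; rcases hx with rfl | rfl
              · exact haK
              · exact hc.2
      · have h3' : 3 ≤ ((Γ.bd S).filter fun e => e ⊆ K).card := by
          apply three_le_of_even _ _ hne0
          · intro e he; exact (bd_card2 (Finset.mem_filter.mp he).1).2
          · intro v
            by_cases hv : v ∈ Z
            · convert h.bd_even hSs v using 2
              rw [Finset.filter_filter]
              apply Finset.filter_congr
              intro e he
              constructor
              · tauto
              · intro hve
                refine ⟨?_, hve⟩
                rcases hbdS e he with h5 | h5
                · exact absurd hv (Finset.disjoint_left.mp h5 hve)
                · exact h5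
            · rw [Finset.filter_eq_empty_iff.mpr]
              · simp
              · intro e he hve
                exact hnK v hv ((Finset.mem_filter.mp he).2 hve)
        refine h3'.trans ?_
        rw [Finset.card_eq_sum_ones]
        calc ∑ e ∈ (Γ.bd S).filter (fun e => e ⊆ K), 1
            = ∑ e ∈ (Γ.bd S).filter (fun e => e ⊆ K), (S.filter fun t => e ⊆ t).card := by
              apply Finset.sum_congr rfl
              intro e he
              rw [bd, Finset.mem_filter, Finset.mem_filter] at he; exact he.1.2.symm
          _ ≤ _ := by
              apply Finset.sum_le_sum_of_subset
              apply Finset.filter_subset_filter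
              exact Finset.filter_subset _ _
    have hApart' : 3 ≤ ∑ e ∈ (Γ.bd S).filter (fun e => Disjoint e Z),
        (S.filter fun t => e ⊆ t).card := by
      refine hApart.trans (le_of_eq ?_)
      rw [Finset.card_eq_sum_ones]
      apply Finset.sum_congr rfl
      intro e he
      rw [bd, Finset.mem_filter, Finset.mem_filter] at he; exact he.1.2.symm
    rw [sum_wt]
    calc 6 ≤ ∑ e ∈ (Γ.bd S).filter (fun e => Disjoint e Z), (S.filter fun t => e ⊆ t).card +
          ∑ e ∈ (Γ.facesOfCard 2).filter (fun e => e ⊆ K), (S.filter fun t => e ⊆ t).card := by omega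
      _ = ∑ e ∈ (Γ.bd S).filter (fun e => Disjoint e Z) ∪
          (Γ.facesOfCard 2).filter (fun e => e ⊆ K), (S.filter fun t => e ⊆ t).card := by
          rw [Finset.sum_union]
          rw [Finset.disjoint_left]
          intro e h5 h6
          rw [Finset.mem_filter] at h5 h6
          exact hexcl e (bd_card2 h5.1).2 h5.2 h6.2
      _ ≤ _ := by
          apply Finset.sum_le_sum_of_subset
          intro e h5
          rw [Finset.mem_union, Finset.mem_filter, Finset.mem_filter] at h5
          rw [Finset.mem_filter, hEf, Finset.mem_filter, Efr, Finset.mem_filter]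
          rcases h5 with h5 | h5
          · exact ⟨mem_foc.mpr (bd_card2 h5.1), by tauto⟩
          · exact ⟨h5.1, by tauto⟩
  obtain ⟨C, hC, hC6⟩ := hsix
  rw [sum_classes (Ef := Ef), ← Finset.add_sum_erase _ _ hC] at hup
  have h7 : 3 * ((triClasses Ef Tf).erase C).card ≤
      ∑ C ∈ (triClasses Ef Tf).erase C, ∑ t ∈ C, Γ.wt Ef t := by
    rw [mul_comm, ← smul_eq_mul, ← Finset.sum_const]
    apply Finset.sum_le_sum
    intro D hD
    exact h3 D (Finset.mem_of_mem_erase hD)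
  rw [Finset.card_erase_of_mem hC] at h7
  have : 0 < (triClasses Ef Tf).card := Finset.card_pos.mpr ⟨C, hC⟩
  omega

end SComplex

namespace SComplex

lemma exc_empty {Δ : SComplex} {k : ℕ} : Δ.exc k ∅ = 0 := by simp [exc, touch]

lemma NPM.exists_adj {Δ : SComplex} {k : ℕ} (h : Δ.NPM k) (hk : 1 ≤ k) {R : Finset ℕ}
    (hR : R ⊆ Δ.vertexSet) (hne : R.Nonempty) (hA : (Δ.vertexSet \ R).Nonempty) :
    ∃ v ∈ Δ.vertexSet \ R, (Δ.nb v ∩ R).Nonempty := by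
  obtain ⟨x, hx⟩ := hne
  obtain ⟨y, hy⟩ := hA
  have hy' := Finset.mem_sdiff.mp hy
  obtain ⟨a, b, hab, ha, hb⟩ := rtg_cross (p := fun z => z ∈ R)
    ((h.conn hk).2 x (hR hx) y hy'.1) hx hy'.2
  rw [nb_edgeRel] at hab
  exact ⟨b, Finset.mem_sdiff.mpr ⟨nb_subset hab, hb⟩, a, Finset.mem_inter.mpr ⟨nb_symm.mp hab, ha⟩⟩

lemma NPM.P_step {k : ℕ} (hk : 2 ≤ k)
    (ih : ∀ (Γ : SComplex), Γ.NPM k → ∀ R ⊆ Γ.vertexSet, k + 1 ≤ (Γ.vertexSet \ R).card →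
      0 ≤ Γ.exc k R) {Δ : SComplex} (h : Δ.NPM (k+1)) {R₀ : Finset ℕ} (hR₀ : R₀ ⊆ Δ.vertexSet)
    (hA₀ : k + 2 ≤ (Δ.vertexSet \ R₀).card) : 0 ≤ Δ.exc (k+1) R₀ := by
  by_contra hneg
  push Not at hneg
  set U := Δ.vertexSet.powerset.filter fun R => k + 2 ≤ (Δ.vertexSet \ R).card with hU
  have memU : ∀ R, R ∈ U ↔ R ⊆ Δ.vertexSet ∧ k + 2 ≤ (Δ.vertexSet \ R).card := by
    intro R; rw [hU, Finset.mem_filter, Finset.mem_powerset]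
  obtain ⟨R, hRU, hmin⟩ := Finset.exists_min_image U
    (fun R => toLex (Δ.exc (k+1) R, R.card)) ⟨R₀, (memU _).mpr ⟨hR₀, hA₀⟩⟩
  have hm1 : ∀ R' ∈ U, Δ.exc (k+1) R ≤ Δ.exc (k+1) R' := by
    intro R' hR'
    have := hmin R' hR'
    rw [Prod.Lex.toLex_le_toLex] at this
    rcases this with h1 | h1
    · exact le_of_lt h1
    · exact le_of_eq h1.1
  have hm2 : ∀ R' ∈ U, Δ.exc (k+1) R' ≤ Δ.exc (k+1) R → R.card ≤ R'.card := by
    intro R' hR' hle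
    have := hmin R' hR'
    rw [Prod.Lex.toLex_le_toLex] at this
    rcases this with h1 | h1
    · simp only at h1; omega
    · exact h1.2
  have hRneg : Δ.exc (k+1) R < 0 :=
    lt_of_le_of_lt (hm1 R₀ ((memU _).mpr ⟨hR₀, hA₀⟩)) hneg
  -- claim
  have claim : ∀ Q ∈ U, Δ.exc (k+1) Q ≤ Δ.exc (k+1) R → Q.card ≤ R.card → ∀ v ∈ Δ.vertexSet \ Q,
      (Δ.nb v ∩ Q).Nonempty → k + 1 ≤ (Δ.nb v \ Q).card → False := by
    intro Q hQ hQe hQc v hv hvQ hdeg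
    rw [Finset.mem_sdiff] at hv
    have hlk : 0 ≤ (Δ.link {v}).exc k (Δ.nb v ∩ Q) := by
      apply ih _ (h.link (mem_vertexSet.mp hv.1)) _ Finset.inter_subset_left
      change k + 1 ≤ (Δ.nb v \ (Δ.nb v ∩ Q)).card
      rwa [Finset.sdiff_inter_self_left]
    have hg := gain (Δ := Δ) (k := k) hv.2
    have hsub : Q \ Δ.nb v ⊆ Q := Finset.sdiff_subset
    have hQ' := (memU _).mp hQ
    have hU' : Q \ Δ.nb v ∈ U := (memU _).mpr ⟨hsub.trans hQ'.1,
      hQ'.2.trans (Finset.card_le_card (Finset.sdiff_subset_sdiff (Finset.Subset.refl _) hsub))⟩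
    have h1 := hm2 _ hU' (by linarith)
    have h2 : (Q \ Δ.nb v).card < Q.card := by
      apply Finset.card_lt_card
      rw [Finset.ssubset_iff_of_subset hsub]
      obtain ⟨x, hx⟩ := hvQ
      rw [Finset.mem_inter] at hx
      exact ⟨x, hx.2, by simp [hx.1]⟩
    omega
  have hR' := (memU _).mp hRU
  have hRne : R.Nonempty := by
    rw [Finset.nonempty_iff_ne_empty]
    rintro rfl
    rw [exc_empty] at hRneg; omega
  have hAne : (Δ.vertexSet \ R).Nonempty := by rw [← Finset.card_pos]; omega
  by_cases hbig : k + 3 ≤ (Δ.vertexSet \ R).card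
  · obtain ⟨v, hv, hvR⟩ := h.exists_adj (by omega) hR'.1 hRne hAne
    refine claim R hRU le_rfl le_rfl v hv hvR ?_
    rw [Finset.mem_sdiff] at hv
    have hins : insert v R ∈ U := by
      rw [memU]
      refine ⟨Finset.insert_subset hv.1 hR'.1, ?_⟩
      rw [Finset.sdiff_insert, Finset.card_erase_of_mem (by simp [hv])]; omega
    have := hm1 _ hins
    rw [exc_insert hv.2] at this
    push_cast at this
    omega
  · have hcard : (Δ.vertexSet \ R).card = k + 1 + 1 := by omega
    obtain ⟨σ, hσ, _, cσ⟩ := h.2.1.2 ∅ h.1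
    have hσV := mem_vs_of_mem hσ
    have hss : Δ.vertexSet \ (Δ.vertexSet \ σ) = σ := Finset.sdiff_sdiff_eq_self hσV
    have hQU : Δ.vertexSet \ σ ∈ U := by
      rw [memU, hss]; exact ⟨Finset.sdiff_subset, by omega⟩
    have hQc : (Δ.vertexSet \ σ).card = R.card := by
      have h1 := Finset.card_sdiff_add_card_eq_card hσV
      have h2 := Finset.card_sdiff_add_card_eq_card hR'.1
      omega
    have hQe : Δ.exc (k+1) (Δ.vertexSet \ σ) ≤ Δ.exc (k+1) R := by
      rw [exc_facet hσ cσ]; exact g2_le_exc hR'.1 hcard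
    obtain ⟨v, hv, hvR⟩ := h.exists_adj (by omega) (Finset.sdiff_subset : Δ.vertexSet \ σ ⊆ _)
      (by rw [← Finset.card_pos, hQc, Finset.card_pos]; exact hRne)
      (by rw [hss, ← Finset.card_pos]; omega)
    refine claim _ hQU hQe hQc.le v hv hvR ?_
    rw [hss] at hv
    have : σ.erase v ⊆ Δ.nb v \ (Δ.vertexSet \ σ) := by
      intro x hx
      rw [Finset.mem_erase] at hx
      rw [Finset.mem_sdiff]
      exact ⟨mem_nb_of_face hσ hv hx.2 hx.1.symm, by simp [hx.2]⟩
    have := Finset.card_le_card this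
    rw [Finset.card_erase_of_mem hv] at this
    omega

lemma NPM.P {k : ℕ} (hk : 2 ≤ k) : ∀ (Γ : SComplex), Γ.NPM k → ∀ R ⊆ Γ.vertexSet,
    k + 1 ≤ (Γ.vertexSet \ R).card → 0 ≤ Γ.exc k R := by
  induction k, hk using Nat.le_induction with
  | base => intro Γ h R hR hA; exact h.P2 hR hA
  | succ k hk ih => intro Γ h R hR hA; exact NPM.P_step hk ih h hR hA

end SComplex

namespace SComplex

lemma g2_le_exc_two {Δ : SComplex} {k : ℕ} {R : Finset ℕ} (hR : R ⊆ Δ.vertexSet)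
    (hc : (Δ.vertexSet \ R).card = k + 2) : Δ.g2 k ≤ Δ.exc k R := by
  rw [exc_formula hR, hc]
  have h1 := edges_in_le (Δ := Δ) (R := R)
  rw [hc] at h1
  have h3 := choose_two_cast (k+2)
  zify at h1
  push_cast at *
  nlinarith

lemma NPM.card_ge {Γ : SComplex} {k : ℕ} (h : Γ.NPM k) (hg : 1 ≤ Γ.g2 k) :
    k + 3 ≤ Γ.vertexSet.card := by
  obtain ⟨σ, hσ, _, cσ⟩ := h.2.1.2 ∅ h.1
  have h1 := Finset.card_le_card (mem_vs_of_mem hσ)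
  by_contra hlt
  have h2 : Γ.vertexSet.card = k + 1 ∨ Γ.vertexSet.card = k + 2 := by omega
  have h3 : Γ.g2 k ≤ Γ.exc k ∅ := by
    rcases h2 with h2 | h2
    · exact g2_le_exc (by simp) (by simpa using h2)
    · exact g2_le_exc_two (by simp) (by simpa using h2)
  rw [exc_empty] at h3
  omega

lemma subgain {Δ : SComplex} {k : ℕ} {R Z : Finset ℕ} {v : ℕ} (hv : v ∉ R)
    (hZ : Z ⊆ Δ.nb v ∩ R) :
    Δ.exc (k+1) (R \ Z) + (Δ.link {v}).exc k (Δ.nb v ∩ R) ≤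
      Δ.exc (k+1) R + (Δ.link {v}).exc k ((Δ.nb v ∩ R) \ Z) := by
  have hZR : Z ⊆ R := hZ.trans Finset.inter_subset_right
  have hsub : (Z.image fun w => ({v, w} : Finset ℕ)) ∪
      (((Δ.link {v}).facesOfCard 2).filter fun e => ¬ Disjoint e (Δ.nb v ∩ R) ∧
        Disjoint e ((Δ.nb v ∩ R) \ Z)) ⊆
      ((Δ.facesOfCard 2).filter fun e => ¬ Disjoint e R ∧ Disjoint e (R \ Z)) := by
    intro e he
    simp only [Finset.mem_union, Finset.mem_image, Finset.mem_filter] at he ⊢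
    rcases he with ⟨w, h1, rfl⟩ | ⟨h1, h2, h3⟩
    · refine ⟨(edge_iff (z := v) (by simp)).mpr ⟨w, (Finset.mem_inter.mp (hZ h1)).1, rfl⟩, ?_, ?_⟩
      · simp [hZR h1]
      · simp [hv, h1]
    · rw [mem_foc, mem_link_singleton] at h1
      refine ⟨?_, ?_, ?_⟩
      · rw [mem_foc]; exact ⟨Δ.down _ h1.1.2 _ (Finset.subset_insert _ _), h1.2⟩
      · intro hd; exact h2 (Finset.disjoint_of_subset_right Finset.inter_subset_right hd)
      · rw [Finset.disjoint_left]
        intro x hx hx'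
        rw [Finset.mem_sdiff] at hx'
        refine Finset.disjoint_left.mp h3 hx ?_
        rw [Finset.mem_sdiff, Finset.mem_inter]
        refine ⟨⟨?_, hx'.1⟩, hx'.2⟩
        apply mem_nb_of_face h1.1.2 (by simp) (by simp [hx])
        rintro rfl; exact h1.1.1 hx
  have hcard := Finset.card_le_card hsub
  rw [Finset.card_union_of_disjoint, Finset.card_image_of_injOn] at hcard
  · have t1 := touch_split (Δ := Δ) (Finset.sdiff_subset : R \ Z ⊆ R)
    have t2 := touch_split (Δ := Δ.link {v})
      (Finset.sdiff_subset : (Δ.nb v ∩ R) \ Z ⊆ Δ.nb v ∩ R)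
    have c1 := Finset.card_sdiff_add_card_eq_card hZR
    have c2 := Finset.card_sdiff_add_card_eq_card hZ
    rw [exc, exc, exc, exc, t1, t2, ← c1, ← c2]
    zify at hcard
    push_cast
    linarith
  · intro a _ b _ hab; exact pair_inj hab
  · rw [Finset.disjoint_left]
    intro e he he'
    simp only [Finset.mem_image, Finset.mem_filter, mem_foc, mem_link_singleton] at he he'
    obtain ⟨w, _, rfl⟩ := he
    apply he'.1.1.1; simp

/-- The standing assumptions: a normal pseudomanifold whose vertex links have positive `g2`. -/
structure Ctx (Δ : SComplex) (k u : ℕ) : Prop where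
  hk : 2 ≤ k
  h : Δ.NPM (k+1)
  hl : ∀ v ∈ Δ.vertexSet, 1 ≤ (Δ.link {v}).g2 k
  hu : {u} ∈ Δ.faces

/-- Sets of vertices outside the closed star of `u`. -/
def Adm (Δ : SComplex) (u : ℕ) (R : Finset ℕ) : Prop :=
  R ⊆ Δ.vertexSet ∧ u ∉ R ∧ Disjoint R (Δ.nb u)

lemma Adm.mono {Δ : SComplex} {u : ℕ} {R Q : Finset ℕ} (h : Δ.Adm u R) (hQ : Q ⊆ R) :
    Δ.Adm u Q :=
  ⟨hQ.trans h.1, fun hh => h.2.1 (hQ hh), Finset.disjoint_of_subset_left hQ h.2.2⟩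

lemma Ctx.lk {Δ : SComplex} {k u : ℕ} (C : Δ.Ctx k u) {v : ℕ} (hv : v ∈ Δ.vertexSet) :
    (Δ.link {v}).NPM k := C.h.link (mem_vertexSet.mp hv)

lemma Ctx.deg {Δ : SComplex} {k u : ℕ} (C : Δ.Ctx k u) {v : ℕ} (hv : v ∈ Δ.vertexSet) :
    k + 3 ≤ (Δ.nb v).card := (C.lk hv).card_ge (C.hl v hv)

lemma Ctx.big {Δ : SComplex} {k u : ℕ} (C : Δ.Ctx k u) {R : Finset ℕ} (hR : Δ.Adm u R) :
    k + 4 ≤ (Δ.vertexSet \ R).card := by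
  have hu := mem_vertexSet.mpr C.hu
  have h1 := C.deg hu
  have h2 : insert u (Δ.nb u) ⊆ Δ.vertexSet \ R := by
    intro x hx
    rw [Finset.mem_insert] at hx
    rw [Finset.mem_sdiff]
    rcases hx with rfl | hx
    · exact ⟨hu, hR.2.1⟩
    · exact ⟨nb_subset hx, fun hh => Finset.disjoint_left.mp hR.2.2 hh hx⟩
  have h3 := Finset.card_le_card h2
  rw [Finset.card_insert_of_notMem not_mem_nb_self] at h3
  omega

lemma Ctx.pos {Δ : SComplex} {k u : ℕ} (C : Δ.Ctx k u) {R : Finset ℕ} (hR : Δ.Adm u R) :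
    0 ≤ Δ.exc (k+1) R :=
  NPM.P (by have := C.hk; omega) _ C.h R hR.1 (by have := C.big hR; omega)

lemma Ctx.lkpos {Δ : SComplex} {k u : ℕ} (C : Δ.Ctx k u) {R : Finset ℕ} {v : ℕ}
    (hv : v ∈ Δ.vertexSet) (hc : k + 1 ≤ (Δ.nb v \ R).card) :
    0 ≤ (Δ.link {v}).exc k (Δ.nb v ∩ R) := by
  apply NPM.P C.hk _ (C.lk hv) _ Finset.inter_subset_left
  change k + 1 ≤ (Δ.nb v \ (Δ.nb v ∩ R)).card
  rwa [Finset.sdiff_inter_self_left]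

lemma Ctx.xgain {Δ : SComplex} {k u : ℕ} (C : Δ.Ctx k u) {R : Finset ℕ} {x : ℕ}
    (hR : R ⊆ Δ.vertexSet) (hx : x ∈ R) (hc : k + 2 ≤ (Δ.nb x \ R).card) :
    Δ.exc (k+1) (R.erase x \ Δ.nb x) + 1 ≤ Δ.exc (k+1) R := by
  have hx' : x ∉ R.erase x := by simp
  have e1 : Δ.nb x \ R.erase x = Δ.nb x \ R := by
    ext y
    simp only [Finset.mem_sdiff, Finset.mem_erase]
    constructor
    · rintro ⟨h1, h2⟩
      refine ⟨h1, fun h3 => h2 ⟨?_, h3⟩⟩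
      exact (mem_nb.mp h1).1
    · tauto
  have h1 := exc_insert (Δ := Δ) (k := k + 1) hx'
  rw [Finset.insert_erase hx, e1] at h1
  have h2 := gain (Δ := Δ) (k := k) hx'
  rw [← e1] at hc
  have h3 := C.lkpos (hR hx) (by omega : k + 1 ≤ (Δ.nb x \ R.erase x).card)
  rw [e1] at hc
  by_cases h4 : (Δ.nb x \ R).card = k + 2
  · have h5 : (Δ.link {x}).g2 k ≤ (Δ.link {x}).exc k (Δ.nb x ∩ R.erase x) := by
      apply g2_le_exc_two (Finset.inter_subset_left)
      change (Δ.nb x \ (Δ.nb x ∩ R.erase x)).card = k + 2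
      rw [Finset.sdiff_inter_self_left, e1, h4]
    have h6 := C.hl x (hR hx)
    rw [h4] at h1
    push_cast at h1
    linarith
  · have h5 : k + 3 ≤ (Δ.nb x \ R).card := by omega
    zify at h5
    push_cast at h1
    linarith

lemma Ctx.adeg {Δ : SComplex} {k u : ℕ} (C : Δ.Ctx k u) {R : Finset ℕ} (hR : Δ.Adm u R)
    (hF : Δ.exc (k+1) R ≤ 1) {v : ℕ} (hv : v ∈ Δ.vertexSet) (hvR : v ∉ R) :
    k + 1 ≤ (Δ.nb v \ R).card := by
  have hb := C.big hR
  have h1 : 0 ≤ Δ.exc (k+1) (insert v R) := by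
    apply NPM.P (by have := C.hk; omega) _ C.h _ (Finset.insert_subset hv hR.1)
    rw [Finset.sdiff_insert, Finset.card_erase_of_mem (by simp [hv, hvR])]
    omega
  rw [exc_insert hvR] at h1
  push_cast at h1
  omega

lemma Ctx.vgain {Δ : SComplex} {k u : ℕ} (C : Δ.Ctx k u) {R : Finset ℕ} (hR : Δ.Adm u R)
    (hF : Δ.exc (k+1) R ≤ 1) {v : ℕ} (hv : v ∈ Δ.vertexSet) (hvR : v ∉ R) :
    Δ.exc (k+1) (R \ Δ.nb v) ≤ Δ.exc (k+1) R := by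
  have h1 := C.lkpos hv (C.adeg hR hF hv hvR)
  have h2 := gain (Δ := Δ) (k := k) hvR
  linarith

lemma Ctx.sep {Δ : SComplex} {k u : ℕ} (C : Δ.Ctx k u) {R : Finset ℕ} (hR : Δ.Adm u R)
    (hne : R.Nonempty) :
    k + 2 ≤ ((Δ.vertexSet \ R).filter fun v => (Δ.nb v ∩ R).Nonempty).card := by
  set S := (Δ.vertexSet \ R).filter fun v => (Δ.nb v ∩ R).Nonempty with hS
  have memS : ∀ v, v ∈ S ↔ (v ∈ Δ.vertexSet ∧ v ∉ R) ∧ (Δ.nb v ∩ R).Nonempty := by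
    intro v; rw [hS, Finset.mem_filter, Finset.mem_sdiff]
  refine C.h.separation (by omega) (X := R) (Y := (Δ.vertexSet \ R) \ S) (S := S)
    ?_ hR.1 (Finset.sdiff_subset.trans Finset.sdiff_subset) hne ?_ ?_ ?_ ?_ ?_
  · intro v hv
    simp only [Finset.mem_union, Finset.mem_sdiff]
    tauto
  · refine ⟨u, ?_⟩
    simp only [Finset.mem_sdiff]
    refine ⟨⟨mem_vertexSet.mpr C.hu, hR.2.1⟩, ?_⟩
    rw [memS]
    rintro ⟨_, z, hz⟩
    rw [Finset.mem_inter] at hz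
    exact Finset.disjoint_left.mp hR.2.2 hz.2 hz.1
  · rw [Finset.disjoint_left]
    intro z hz hz'
    exact ((memS z).mp hz').1.2 hz
  · exact Finset.sdiff_disjoint
  · intro x hx y hy hxy
    simp only [Finset.mem_sdiff] at hy
    apply hy.2
    rw [memS]
    exact ⟨hy.1, x, Finset.mem_inter.mpr ⟨nb_symm.mp hxy, hx⟩⟩
  · rw [Finset.disjoint_left]
    intro z hz hz'
    simp only [Finset.mem_sdiff] at hz'
    exact hz'.1.2 hz

lemma sdiff_nb_lt {Δ : SComplex} {R : Finset ℕ} {v : ℕ} (h : (Δ.nb v ∩ R).Nonempty) :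
    (R \ Δ.nb v).card < R.card := by
  apply Finset.card_lt_card
  rw [Finset.ssubset_iff_of_subset Finset.sdiff_subset]
  obtain ⟨x, hx⟩ := h
  rw [Finset.mem_inter] at hx
  exact ⟨x, hx.2, by simp [hx.1]⟩

lemma Ctx.Q {Δ : SComplex} {k u : ℕ} (C : Δ.Ctx k u) (n : ℕ) : ∀ {R : Finset ℕ}, R.card = n →
    Δ.Adm u R → R.Nonempty → 1 ≤ Δ.exc (k+1) R := by
  induction n using Nat.strong_induction_on with
  | _ n ih =>
    intro R hn hR hne
    by_contra hF
    have hF0 : Δ.exc (k+1) R ≤ 0 := by omega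
    have hsep := C.sep hR hne
    obtain ⟨x, hx⟩ := hne
    have hsub : ((Δ.vertexSet \ R).filter fun v => (Δ.nb v ∩ R).Nonempty) ⊆ Δ.nb x \ R := by
      intro v hv
      rw [Finset.mem_filter, Finset.mem_sdiff] at hv
      rw [Finset.mem_sdiff]
      refine ⟨?_, hv.1.2⟩
      have h1 := C.vgain hR (by omega) hv.1.1 hv.1.2
      have h2 := sdiff_nb_lt hv.2
      by_contra hxv
      have := ih _ (by omega) (R := R \ Δ.nb v) rfl (hR.mono Finset.sdiff_subset)
        ⟨x, by rw [Finset.mem_sdiff]; exact ⟨hx, fun hh => hxv (nb_symm.mp hh)⟩⟩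
      omega
    have h1 := Finset.card_le_card hsub
    have h2 := C.xgain hR.1 hx (by omega)
    have h3 := C.pos (hR.mono (Finset.sdiff_subset.trans (Finset.erase_subset x R)) :
      Δ.Adm u (R.erase x \ Δ.nb x))
    omega

end SComplex

namespace SComplex

/-- A minimal counterexample to the clique claim. -/
structure Bad (Δ : SComplex) (k u : ℕ) (R : Finset ℕ) (x y : ℕ) : Prop where
  hR : Δ.Adm u R
  hF : Δ.exc (k+1) R ≤ 1
  hmin : ∀ Q : Finset ℕ, Δ.Adm u Q → Q.card < R.card → Δ.exc (k+1) Q ≤ 1 →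
    ∀ a ∈ Q, ∀ b ∈ Q, a ≠ b → b ∈ Δ.nb a
  hx : x ∈ R
  hy : y ∈ R
  hne : x ≠ y
  hxy : y ∉ Δ.nb x

lemma Bad.symm {Δ : SComplex} {k u : ℕ} {R : Finset ℕ} {x y : ℕ} (B : Δ.Bad k u R x y) :
    Δ.Bad k u R y x :=
  ⟨B.hR, B.hF, B.hmin, B.hy, B.hx, B.hne.symm, fun h => B.hxy (nb_symm.mp h)⟩

lemma Bad.small {Δ : SComplex} {k u : ℕ} {R : Finset ℕ} {x y : ℕ} (C : Δ.Ctx k u)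
    (B : Δ.Bad k u R x y) : (Δ.nb x \ R).card ≤ k + 1 := by
  by_contra hlt
  have h1 := C.xgain B.hR.1 B.hx (by omega)
  have h2 := C.Q _ (R := R.erase x \ Δ.nb x) rfl
    (B.hR.mono (Finset.sdiff_subset.trans (Finset.erase_subset x R)))
    ⟨y, by simp [B.hy, B.hne.symm, B.hxy]⟩
  have := B.hF
  omega

lemma Bad.exists_v {Δ : SComplex} {k u : ℕ} {R : Finset ℕ} {x y : ℕ} (C : Δ.Ctx k u)
    (B : Δ.Bad k u R x y) : ∃ v, v ∈ Δ.vertexSet ∧ v ∉ R ∧ x ∈ Δ.nb v ∧ y ∉ Δ.nb v := by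
  have h1 := C.sep B.hR ⟨x, B.hx⟩
  have h2 := B.symm.small C
  obtain ⟨v, hv, hv'⟩ := Finset.exists_mem_notMem_of_card_lt_card (lt_of_le_of_lt h2 h1)
  rw [Finset.mem_filter, Finset.mem_sdiff] at hv
  have hyv : y ∉ Δ.nb v := by
    intro h3
    exact hv' (Finset.mem_sdiff.mpr ⟨nb_symm.mp h3, hv.1.2⟩)
  refine ⟨v, hv.1.1, hv.1.2, ?_, hyv⟩
  by_contra hxv
  have h3 := C.vgain B.hR B.hF hv.1.1 hv.1.2
  have := B.hmin _ (B.hR.mono Finset.sdiff_subset) (sdiff_nb_lt hv.2) (h3.trans B.hF)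
    x (by simp [B.hx, hxv]) y (by simp [B.hy, hyv]) B.hne
  exact B.hxy this

lemma Bad.facts {Δ : SComplex} {k u : ℕ} {R : Finset ℕ} {x y v : ℕ} (C : Δ.Ctx k u)
    (B : Δ.Bad k u R x y) (hv : v ∈ Δ.vertexSet) (hvR : v ∉ R) (hxv : x ∈ Δ.nb v)
    (hyv : y ∉ Δ.nb v) :
    Δ.exc (k+1) (R \ Δ.nb v) = 1 ∧
    (∀ a ∈ R \ Δ.nb v, ∀ b ∈ R \ Δ.nb v, a ≠ b → b ∈ Δ.nb a) ∧
    (Δ.link {v}).exc k (Δ.nb v ∩ R) ≤ 0 ∧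
    (k + 2 ≤ (Δ.nb v \ R).card) ∧
    ∀ v' ∈ Δ.nb v \ R, k + 1 ≤ ((Δ.link {v}).nb v' \ (Δ.nb v ∩ R)).card := by
  have hne : (Δ.nb v ∩ R).Nonempty := ⟨x, by simp [hxv, B.hx]⟩
  have had : Δ.Adm u (R \ Δ.nb v) := B.hR.mono Finset.sdiff_subset
  have h1 := C.Q _ rfl had ⟨y, by simp [hyv, B.hy]⟩
  have h2 := C.vgain B.hR B.hF hv hvR
  have h3 := gain (Δ := Δ) (k := k) hvR
  have hF := B.hF
  have h4 := C.adeg B.hR B.hF hv hvR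
  have h5 : (Δ.link {v}).exc k (Δ.nb v ∩ R) ≤ 0 := by linarith
  have hdiff : (Δ.link {v}).vertexSet \ (Δ.nb v ∩ R) = Δ.nb v \ R := by
    change Δ.nb v \ (Δ.nb v ∩ R) = _
    rw [Finset.sdiff_inter_self_left]
  have h6 : k + 2 ≤ (Δ.nb v \ R).card := by
    by_contra hlt
    have : (Δ.link {v}).g2 k ≤ (Δ.link {v}).exc k (Δ.nb v ∩ R) := by
      refine g2_le_exc (show Δ.nb v ∩ R ⊆ (Δ.link {v}).vertexSet from Finset.inter_subset_left) ?_
      change ((Δ.link {v}).vertexSet \ (Δ.nb v ∩ R)).card = k + 1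
      rw [hdiff]; omega
    have := C.hl v hv
    linarith
  refine ⟨by linarith, B.hmin _ had (sdiff_nb_lt hne) (h2.trans hF), h5, h6, ?_⟩
  intro v' hv'
  rw [Finset.mem_sdiff] at hv'
  have hnot : v' ∉ Δ.nb v ∩ R := by simp [hv'.2]
  have h7 : 0 ≤ (Δ.link {v}).exc k (insert v' (Δ.nb v ∩ R)) := by
    apply NPM.P C.hk _ (C.lk hv) _ (Finset.insert_subset hv'.1 Finset.inter_subset_left)
    change k + 1 ≤ ((Δ.link {v}).vertexSet \ insert v' (Δ.nb v ∩ R)).card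
    rw [Finset.sdiff_insert, hdiff, Finset.card_erase_of_mem (by simp [hv'])]
    omega
  rw [exc_insert hnot] at h7
  omega

lemma Bad.high {Δ : SComplex} {m u : ℕ} {R : Finset ℕ} {x y : ℕ} (hm : 2 ≤ m)
    (C : Δ.Ctx (m+1) u) (B : Δ.Bad (m+1) u R x y) : False := by
  obtain ⟨v, hv, hvR, hxv, hyv⟩ := B.exists_v C
  obtain ⟨_, _, h3, h4, h5⟩ := B.facts C hv hvR hxv hyv
  set Γ := Δ.link {v} with hΓ
  set Z := Δ.nb v ∩ R with hZ
  have hΓn : Γ.NPM (m+1) := C.lk hv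
  have hΓV : Γ.vertexSet = Δ.nb v := rfl
  have key : ∀ v' ∈ Δ.nb v \ R, (Γ.nb v' ∩ Z).Nonempty → x ∈ Γ.nb v' := by
    intro v' hv' hne
    by_contra hx
    have hdeg := h5 v' hv'
    rw [Finset.mem_sdiff] at hv'
    have hv'Z : v' ∉ Z := by simp [hZ, hv'.2]
    have g1 := gain (Δ := Γ) (k := m) hv'Z
    have g2 : 0 ≤ (Γ.link {v'}).exc m (Γ.nb v' ∩ Z) := by
      apply NPM.P hm _ (hΓn.link (mem_vertexSet.mp (hΓV ▸ hv'.1))) _ Finset.inter_subset_left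
      change m + 1 ≤ (Γ.nb v' \ (Γ.nb v' ∩ Z)).card
      rw [Finset.sdiff_inter_self_left]; omega
    have g3 := subgain (Δ := Δ) (k := m + 1) hvR
      (Finset.inter_subset_right : Γ.nb v' ∩ Z ⊆ Z)
    have e : Z \ (Γ.nb v' ∩ Z) = Z \ Γ.nb v' := by
      rw [Finset.inter_comm, Finset.sdiff_inter_self_left]
    rw [← hZ, ← hΓ, e] at g3
    have hlt : (R \ (Γ.nb v' ∩ Z)).card < R.card := by
      apply Finset.card_lt_card
      rw [Finset.ssubset_iff_of_subset Finset.sdiff_subset]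
      obtain ⟨z, hz⟩ := hne
      refine ⟨z, ?_, by rw [Finset.mem_sdiff]; tauto⟩
      exact Finset.inter_subset_right (Finset.inter_subset_right hz)
    have hF := B.hF
    refine B.hxy (B.hmin _ (B.hR.mono Finset.sdiff_subset) hlt (by linarith) x ?_ y ?_ B.hne)
    · simp [B.hx, hx]
    · simp [B.hy, hZ, hyv]
  set S := (Δ.nb v \ R).filter fun v' => (Γ.nb v' ∩ Z).Nonempty with hS
  have memS : ∀ w, w ∈ S ↔ (w ∈ Δ.nb v ∧ w ∉ R) ∧ (Γ.nb w ∩ Z).Nonempty := by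
    intro w; rw [hS, Finset.mem_filter, Finset.mem_sdiff]
  have hScard : m + 2 ≤ S.card := by
    by_cases hall : ((Δ.nb v \ R) \ S).Nonempty
    · refine hΓn.separation (by omega) (X := Z) (Y := (Δ.nb v \ R) \ S) (S := S)
        ?_ Finset.inter_subset_left (Finset.sdiff_subset.trans Finset.sdiff_subset)
        ⟨x, by simp [hZ, hxv, B.hx]⟩ hall ?_ Finset.sdiff_disjoint ?_ ?_
      · intro w hw
        rw [hΓV] at hw
        simp only [hZ, Finset.mem_union, Finset.mem_sdiff, Finset.mem_inter]
        tauto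
      · rw [Finset.disjoint_left]
        intro z hz hz'
        exact ((memS z).mp hz').1.2 (Finset.inter_subset_right hz)
      · intro a ha b hb hab
        simp only [Finset.mem_sdiff] at hb
        apply hb.2
        rw [memS]
        exact ⟨hb.1, a, Finset.mem_inter.mpr ⟨nb_symm.mp hab, ha⟩⟩
      · rw [Finset.disjoint_left]
        intro z hz hz'
        simp only [Finset.mem_sdiff] at hz'
        exact hz'.1.2 (Finset.inter_subset_right hz)
    · rw [Finset.not_nonempty_iff_eq_empty, Finset.sdiff_eq_empty_iff_subset] at hall
      have := Finset.card_le_card hall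
      omega
  have hvS : v ∉ S := by
    rw [memS]; intro hh; exact not_mem_nb_self hh.1.1
  have hsub : insert v S ⊆ Δ.nb x \ R := by
    intro w hw
    rw [Finset.mem_insert] at hw
    rw [Finset.mem_sdiff]
    rcases hw with rfl | hw
    · exact ⟨nb_symm.mp hxv, hvR⟩
    · rw [memS] at hw
      refine ⟨?_, hw.1.2⟩
      have h6 := key w (Finset.mem_sdiff.mpr hw.1) hw.2
      rw [mem_nb] at h6
      rw [nb_symm, mem_nb]
      refine ⟨h6.1, ?_⟩
      have h7 := h6.2
      rw [hΓ, mem_link_singleton] at h7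
      exact Δ.down _ h7.2 _ (Finset.subset_insert _ _)
  have h6 := Finset.card_le_card hsub
  rw [Finset.card_insert_of_notMem hvS] at h6
  have h7 := B.small C
  omega

lemma NPM.three_f2 {Γ : SComplex} (h : Γ.NPM 2) :
    3 * (Γ.facesOfCard 3).card = 2 * (Γ.facesOfCard 2).card := by
  have h1 := h.three_tri (Finset.Subset.refl (Γ.facesOfCard 2))
    (Finset.Subset.refl (Γ.facesOfCard 3)) (fun _ _ t ht _ => ht)
  rw [h1, Finset.sum_eq_zero]
  · rfl
  · intro t _
    rw [wt, Finset.card_eq_zero, Finset.filter_eq_empty_iff]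
    intro e he; tauto

lemma NPM.card_ge_six {Γ : SComplex} (h : Γ.NPM 2) (hg : 1 ≤ Γ.g2 2) :
    6 ≤ Γ.vertexSet.card := by
  have h1 := h.card_ge hg
  by_contra hlt
  have h2 : Γ.vertexSet.card = 5 := by omega
  have h3 := h.three_f2
  have h4 := edges_in_le (Δ := Γ) (R := ∅)
  rw [g2, fVec_zero, fVec_one, h2] at hg
  have e : (Γ.facesOfCard 2).filter (fun e => Disjoint e ∅) = Γ.facesOfCard 2 := by simp
  rw [e, Finset.sdiff_empty, h2] at h4
  have c1 : Nat.choose 5 2 = 10 := by decide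
  have c2 : Nat.choose (2 + 2) 2 = 6 := by decide
  rw [c1] at h4
  rw [c2] at hg
  push_cast at hg
  omega

lemma Ctx.five {Δ : SComplex} {u : ℕ} (C : Δ.Ctx 2 u) {K : Finset ℕ} (hK : K ⊆ Δ.vertexSet)
    (hne : K.Nonempty) (hF : Δ.exc 3 K ≤ 1) : 5 ≤ K.card := by
  have h1 := touch_deg (Δ := Δ) (m := 6) K
    (fun z hz => (C.lk (hK hz)).card_ge_six (C.hl z (hK hz)))
  rw [exc] at hF
  have h2 := Finset.card_pos.mpr hne
  by_contra hlt
  have h3 : K.card = 1 ∨ K.card = 2 ∨ K.card = 3 ∨ K.card = 4 := by omega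
  rcases h3 with h3 | h3 | h3 | h3 <;> rw [h3] at h1 hF <;> norm_num [Nat.choose] at h1 hF <;> omega

lemma Bad.low {Δ : SComplex} {u : ℕ} {R : Finset ℕ} {x y : ℕ}
    (C : Δ.Ctx 2 u) (B : Δ.Bad 2 u R x y) : False := by
  obtain ⟨v, hv, hvR, hxv, hyv⟩ := B.exists_v C
  obtain ⟨w, hw, hwR, hyw, hxw⟩ := B.symm.exists_v C
  obtain ⟨v1, v2, v3, v4, v5⟩ := B.facts C hv hvR hxv hyv
  obtain ⟨w1, w2, -, -, -⟩ := B.symm.facts C hw hwR hyw hxw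
  have hF := B.hF
  have hxKw : x ∈ R \ Δ.nb w := by simp [B.hx, hxw]
  have hyKv : y ∈ R \ Δ.nb v := by simp [B.hy, hyv]
  have hxKv : x ∉ R \ Δ.nb v := by simp [hxv]
  have hyKw : y ∉ R \ Δ.nb w := by simp [hyw]
  have aKv : Δ.Adm u (R \ Δ.nb v) := B.hR.mono Finset.sdiff_subset
  have aKw : Δ.Adm u (R \ Δ.nb w) := B.hR.mono Finset.sdiff_subset
  have hKwR : R \ Δ.nb w ⊆ R := Finset.sdiff_subset
  have hKvR : R \ Δ.nb v ⊆ R := Finset.sdiff_subset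
  by_cases hK0 : ((R \ Δ.nb v) ∩ (R \ Δ.nb w)).Nonempty
  · set Kv := R \ Δ.nb v with hKv
    set Kw := R \ Δ.nb w with hKw
    have s1 := submod (Δ := Δ) (k := 3) Kv Kw
    have aK0 : Δ.Adm u (Kv ∩ Kw) := aKv.mono Finset.inter_subset_left
    have q0 := C.Q _ rfl aK0 hK0
    norm_num at v1 w1 q0 hF
    have aU : Δ.Adm u (Kv ∪ Kw) := B.hR.mono (Finset.union_subset hKvR hKwR)
    have hU : Kv ∪ Kw = R := by
      apply Finset.eq_of_subset_of_card_le (Finset.union_subset hKvR hKwR)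
      by_contra hlt
      exact B.hxy (B.hmin _ aU (by omega) (by norm_num; omega) x (by simp [hxKw]) y
        (by simp [hyKv]) B.hne)
    have q1 := C.Q _ rfl aU ⟨x, by simp [hxKw]⟩
    norm_num at q1
    have f0 : Δ.exc 3 (Kv ∩ Kw) = 1 := by omega
    have cross : ((Δ.facesOfCard 2).filter fun e =>
      ¬ Disjoint e (Kv \ Kw) ∧ ¬ Disjoint e (Kw \ Kv)).card = 0 := by omega
    rw [Finset.card_eq_zero, Finset.filter_eq_empty_iff] at cross
    have hnbx : Kv \ Δ.nb x = Kv \ (Kv ∩ Kw) := by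
      ext z
      simp only [Finset.mem_sdiff, Finset.mem_inter]
      constructor
      · rintro ⟨h1, h2⟩
        refine ⟨h1, fun h3 => h2 ?_⟩
        refine w2 x hxKw z h3.2 ?_
        rintro rfl; exact hxKv h1
      · rintro ⟨h1, h2⟩
        refine ⟨h1, fun h3 => ?_⟩
        have h4 : z ∉ Kw := fun h5 => h2 ⟨h1, h5⟩
        refine cross (x := {x, z}) ((edge_iff (z := x) (by simp)).mpr ⟨z, h3, rfl⟩) ⟨?_, ?_⟩
        · rw [Finset.not_disjoint_iff]
          exact ⟨z, by simp, by simp [h1, h4]⟩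
        · rw [Finset.not_disjoint_iff]
          exact ⟨x, by simp, by simp [hxKw, hxKv]⟩
    have g1 := C.vgain aKv (by norm_num; omega) (B.hR.1 B.hx) hxKv
    rw [hnbx] at g1
    change Δ.exc 3 _ ≤ Δ.exc 3 _ at g1
    have s2 := submod (Δ := Δ) (k := 3) (Kv ∩ Kw) (Kv \ (Kv ∩ Kw))
    rw [Finset.union_sdiff_of_subset Finset.inter_subset_left, Finset.inter_sdiff_self,
      exc_empty] at s2
    have c5 := C.five aK0.1 hK0 (by omega)
    have hle : (Kv ∩ Kw).card ≤ ((Δ.facesOfCard 2).filter fun e =>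
      ¬ Disjoint e ((Kv ∩ Kw) \ (Kv \ (Kv ∩ Kw))) ∧
      ¬ Disjoint e ((Kv \ (Kv ∩ Kw)) \ (Kv ∩ Kw))).card := by
      have : (Kv ∩ Kw).card = ((Kv ∩ Kw).image fun z => ({y, z} : Finset ℕ)).card := by
        rw [Finset.card_image_of_injOn]
        intro a _ b _ hab; exact pair_inj hab
      rw [this]
      apply Finset.card_le_card
      intro e he
      rw [Finset.mem_image] at he
      obtain ⟨z, hz, rfl⟩ := he
      have hz' := Finset.mem_inter.mp hz
      rw [Finset.mem_filter]
      refine ⟨(edge_iff (z := y) (by simp)).mpr ⟨z, v2 y hyKv z hz'.1 ?_, rfl⟩, ?_, ?_⟩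
      · rintro rfl; exact hyKw hz'.2
      · rw [Finset.not_disjoint_iff]
        exact ⟨z, by simp, by simp [hz']⟩
      · rw [Finset.not_disjoint_iff]
        exact ⟨y, by simp, by simp [hyKv, hyKw]⟩
    omega
  · have c5 := C.five aKw.1 ⟨x, hxKw⟩ (by norm_num at w1; omega)
    obtain ⟨K, hKsub, hKc⟩ := Finset.exists_subset_card_eq c5
    have hKZ : K ⊆ Δ.nb v ∩ R := by
      intro z hz
      have hz' := hKsub hz
      rw [Finset.mem_inter]
      refine ⟨?_, hKwR hz'⟩
      by_contra hzv
      exact hK0 ⟨z, Finset.mem_inter.mpr ⟨Finset.mem_sdiff.mpr ⟨hKwR hz', hzv⟩, hz'⟩⟩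
    have hdiff : (Δ.link {v}).vertexSet \ (Δ.nb v ∩ R) = Δ.nb v \ R := by
      change Δ.nb v \ (Δ.nb v ∩ R) = _
      rw [Finset.sdiff_inter_self_left]
    have hAne : (Δ.nb v \ R).Nonempty := by rw [← Finset.card_pos]; omega
    refine (C.lk hv).L2 (Z := Δ.nb v ∩ R) Finset.inter_subset_left (by rw [hdiff]; exact hAne)
      ?_ v3 hKZ hKc ?_
    · obtain ⟨v', hv'⟩ := hAne
      have h1 := v5 v' hv'
      rw [Finset.mem_sdiff] at hv'
      have : ((Δ.link {v}).nb v' \ (Δ.nb v ∩ R)).card =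
          (((Δ.link {v}).nb v' \ (Δ.nb v ∩ R)).image fun z => ({v', z} : Finset ℕ)).card := by
        rw [Finset.card_image_of_injOn]
        intro a _ b _ hab; exact pair_inj hab
      rw [this] at h1
      refine le_trans (by omega) (h1.trans (Finset.card_le_card ?_))
      intro e he
      rw [Finset.mem_image] at he
      obtain ⟨z, hz, rfl⟩ := he
      rw [Finset.mem_sdiff] at hz
      rw [Finset.mem_filter]
      refine ⟨(edge_iff (z := v') (by simp)).mpr ⟨z, hz.1, rfl⟩, ?_⟩
      rw [Finset.disjoint_insert_left, Finset.disjoint_singleton_left]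
      exact ⟨by simp [hv'.2], hz.2⟩
    · intro a ha b hb hab
      have hge := C.lkpos hv (by omega : 2 + 1 ≤ (Δ.nb v \ R).card)
      exact gain_eq hvR (by linarith) (hKZ ha) (hKZ hb) (w2 a (hKsub ha) b (hKsub hb) hab)

lemma Ctx.T {Δ : SComplex} {k u : ℕ} (C : Δ.Ctx k u) (n : ℕ) : ∀ R : Finset ℕ, R.card = n →
    Δ.Adm u R → Δ.exc (k+1) R ≤ 1 → ∀ a ∈ R, ∀ b ∈ R, a ≠ b → b ∈ Δ.nb a := by
  induction n using Nat.strong_induction_on with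
  | _ n ih =>
    intro R hn hR hF x hx y hy hne
    by_contra hxy
    have B : Δ.Bad k u R x y :=
      ⟨hR, hF, fun Q hQ hc hQF => ih _ (by omega) Q rfl hQ hQF, hx, hy, hne, hxy⟩
    have hk := C.hk
    obtain rfl | hk2 := hk.eq_or_lt
    · exact B.low C
    · obtain ⟨m, rfl⟩ : ∃ m, k = m + 1 := ⟨k - 1, by omega⟩
      exact B.high (by omega) C

lemma final (d : ℕ) (hd : 3 ≤ d) (Δ : SComplex) (p : ℤ)
    (hpm : Δ.IsNormalPseudomanifold d) (hp : Δ.g2 d = p)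
    (hlinks : ∀ v ∈ Δ.vertexSet, 1 ≤ (Δ.link {v}).g2 (d - 1))
    (u : ℕ) (hu : ({u} : Finset ℕ) ∈ Δ.faces)
    (hstar : (Δ.induced (Δ.closedStarVerts u)).g2 d = p - 1) :
    ∀ x ∈ Δ.vertexSet, ∀ y ∈ Δ.vertexSet,
      x ∉ Δ.closedStarVerts u → y ∉ Δ.closedStarVerts u → x ≠ y →
      ({x, y} : Finset ℕ) ∈ Δ.faces := by
  obtain ⟨k, rfl⟩ : ∃ k, d = k + 1 := ⟨d - 1, by omega⟩
  have hn : Δ.NPM (k+1) := ⟨Δ.down _ hu _ (by simp), hpm.1, hpm.2.2.1, hpm.2.2.2⟩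
  have C : Δ.Ctx k u := ⟨by omega, hn, by simpa using hlinks, hu⟩
  have hW : Δ.closedStarVerts u ⊆ Δ.vertexSet :=
    Finset.insert_subset (mem_vertexSet.mpr hu) (fun z hz => nb_subset (v := u) hz)
  have hexc := induced_g2 (k := k + 1) hW
  rw [hp, hstar] at hexc
  have hadm : Δ.Adm u (Δ.vertexSet \ Δ.closedStarVerts u) := by
    refine ⟨Finset.sdiff_subset, by simp [closedStarVerts], ?_⟩
    rw [Finset.disjoint_left]
    intro z hz hz'
    exact (Finset.mem_sdiff.mp hz).2 (Finset.mem_insert_of_mem hz')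
  intro x hx y hy hxu hyu hxy
  exact (mem_nb.mp (C.T _ _ rfl hadm (by linarith) x (by simp [hx, hxu]) y
    (by simp [hy, hyu]) hxy)).2

end SComplex

/-- Let `d ≥ 3` and `Δ` a normal `d`-pseudomanifold with
`g₂(Δ) = p` such that `g₂(lk_Δ v) ≥ 1` for every vertex `v`. If `u` is a
vertex with `g₂(Δ[V(st_Δ u)]) = p - 1`, then any two vertices of `Δ` outside
`st_Δ u` are joined by an edge of `Δ`. -/
theorem statement5 (d : ℕ) (hd : 3 ≤ d) (Δ : SComplex) (p : ℤ)
    (hpm : Δ.IsNormalPseudomanifold d) (hp : Δ.g2 d = p)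
    (hlinks : ∀ v ∈ Δ.vertexSet, 1 ≤ (Δ.link {v}).g2 (d - 1))
    (u : ℕ) (hu : ({u} : Finset ℕ) ∈ Δ.faces)
    (hstar : (Δ.induced (Δ.closedStarVerts u)).g2 d = p - 1) :
    ∀ x ∈ Δ.vertexSet, ∀ y ∈ Δ.vertexSet,
      x ∉ Δ.closedStarVerts u → y ∉ Δ.closedStarVerts u → x ≠ y →
      ({x, y} : Finset ℕ) ∈ Δ.faces := by
  exact SComplex.final d hd Δ p hpm hp hlinks u hu hstar
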